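/- Let Ω be a strictly convex, centrally symmetric, open bounded domain in R² with connected C^∞ boundary that is not a disk, and let ω be a nontrivial solution of −Δω = μω in Ω, ∂ω/∂n = 0 on ∂Ω, ω = c ≠ 0 on ∂Ω, with Rω = −y ω_x + x ω_y. Then Rω has at least 6 nodal domains in Ω (i.e., the complement in Ω of the zero set of Rω has at least 6 connected components). -/

import Mathlib

noncomputable section
open Real MeasureTheory ComplexConjugate

/-- Partial derivative in the `x` direction. -/
def pdx (u : ℝ × ℝ → ℝ) (p : ℝ × ℝ) : ℝ := fderiv ℝ u p (1, 0)

/-- Partial derivative in the `y` direction. -/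
def pdy (u : ℝ × ℝ → ℝ) (p : ℝ × ℝ) : ℝ := fderiv ℝ u p (0, 1)

/-- The Laplacian on `ℝ²`. -/
def lap (u : ℝ × ℝ → ℝ) (p : ℝ × ℝ) : ℝ := pdx (pdx u) p + pdy (pdy u) p

/-- Partial derivative in the `x` direction, for complex-valued functions. -/
def pdxC (u : ℝ × ℝ → ℂ) (p : ℝ × ℝ) : ℂ := fderiv ℝ u p (1, 0)

/-- Partial derivative in the `y` direction, for complex-valued functions. -/
def pdyC (u : ℝ × ℝ → ℂ) (p : ℝ × ℝ) : ℂ := fderiv ℝ u p (0, 1)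

/-- Normal derivative with respect to the outward unit normal
`n = (sin θ, -cos θ)`, where `θ` is the tangent angle at the boundary point. -/
def nderiv (th : ℝ) (u : ℝ × ℝ → ℝ) (p : ℝ × ℝ) : ℝ :=
  Real.sin th * pdx u p - Real.cos th * pdy u p

/-- Normal derivative for complex-valued functions. -/
def nderivC (th : ℝ) (u : ℝ × ℝ → ℂ) (p : ℝ × ℝ) : ℂ :=
  (Real.sin th : ℂ) * pdxC u p - (Real.cos th : ℂ) * pdyC u p

/-- The rotation generator `R = -y ∂/∂x + x ∂/∂y`. -/
def Rop (u : ℝ × ℝ → ℝ) (p : ℝ × ℝ) : ℝ := -p.2 * pdx u p + p.1 * pdy u p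

/-- The scaling generator `S = x ∂/∂x + y ∂/∂y`. -/
def Sop (u : ℝ × ℝ → ℝ) (p : ℝ × ℝ) : ℝ := p.1 * pdx u p + p.2 * pdy u p

/-- `Ω` is a (Euclidean) disk. -/
def IsDisk (Om : Set (ℝ × ℝ)) : Prop :=
  ∃ z : ℝ × ℝ, ∃ r : ℝ, 0 < r ∧
    Om = {p : ℝ × ℝ | (p.1 - z.1) ^ 2 + (p.2 - z.2) ^ 2 < r ^ 2}

/-- `u` is `C^∞` on the closure of `Ω` (i.e. on an open neighborhood of it). -/
def SmoothNearClosure (Om : Set (ℝ × ℝ)) (u : ℝ × ℝ → ℝ) : Prop :=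
  ∃ U : Set (ℝ × ℝ), IsOpen U ∧ closure Om ⊆ U ∧ ContDiffOn ℝ (⊤ : ℕ∞) u U

/-- Complexified gradient `∇u = u_x + i u_y`. -/
def gradC (u : ℝ × ℝ → ℝ) (p : ℝ × ℝ) : ℂ :=
  (pdx u p : ℂ) + Complex.I * (pdy u p : ℂ)

/-- Complexified conjugate gradient `∇̄u = u_x - i u_y`. -/
def gradbarC (u : ℝ × ℝ → ℝ) (p : ℝ × ℝ) : ℂ :=
  (pdx u p : ℂ) - Complex.I * (pdy u p : ℂ)

/-- The bilinear form `B(φ, ψ; λ) = ∫∫_Ω (φ_x ψ̄_x + φ_y ψ̄_y - λ φ ψ̄)`. -/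
def Bform (Om : Set (ℝ × ℝ)) (lam : ℝ) (phi psi : ℝ × ℝ → ℂ) : ℂ :=
  ∫ p in Om, (pdxC phi p * conj (pdxC psi p) + pdyC phi p * conj (pdyC psi p)
    - (lam : ℂ) * phi p * conj (psi p))


lemma sixnd_step (l : ℝ → ℂ) (hl : Continuous l) (w : ℂ)
    (hw : ∀ s, 0 < (w * Complex.exp (l s)).re)
    (hneg : (Complex.exp (l 1) * conj (Complex.exp (l 0))).im < 0) :
    (l 1).im < (l 0).im := by
  have key : ∀ s, ∀ k : ℝ, (l s).im = (l 0).im + k → Real.cos k = -1 → False := by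
    intro s k hk hc
    have hs : Real.sin k = 0 := by
      have := Real.sin_sq_add_cos_sq k
      rw [hc] at this
      nlinarith
    have h0 := hw 0
    have h1 := hw s
    rw [Complex.mul_re, Complex.exp_re, Complex.exp_im] at h0 h1
    rw [hk, Real.cos_add, Real.sin_add, hc, hs] at h1
    have e0 := Real.exp_pos (l 0).re
    have e1 := Real.exp_pos (l s).re
    have h0' : 0 < w.re * Real.cos (l 0).im - w.im * Real.sin (l 0).im := by
      by_contra hcon
      push Not at hcon
      nlinarith
    nlinarith [mul_pos e1 h0']
  have hcont : Continuous fun s => (l s).im := Complex.continuous_im.comp hl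
  have hlt : |(l 1).im - (l 0).im| < π := by
    by_contra hcon
    push Not at hcon
    rcases le_abs.1 hcon with h | h
    · obtain ⟨s, -, hs⟩ := intermediate_value_Icc (zero_le_one' ℝ) hcont.continuousOn
        (show (l 0).im + π ∈ Set.Icc (l 0).im (l 1).im from
          ⟨by linarith [Real.pi_pos], by linarith⟩)
      exact key s π hs Real.cos_pi
    · obtain ⟨s, -, hs⟩ := intermediate_value_Icc' (zero_le_one' ℝ) hcont.continuousOn
        (show (l 0).im + -π ∈ Set.Icc (l 1).im (l 0).im from
          ⟨by linarith, by linarith [Real.pi_pos]⟩)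
      exact key s (-π) hs (by rw [Real.cos_neg, Real.cos_pi])
  have hsin : Real.sin ((l 1).im - (l 0).im) < 0 := by
    rw [Complex.mul_im, Complex.conj_re, Complex.conj_im, Complex.exp_re, Complex.exp_im,
      Complex.exp_re, Complex.exp_im] at hneg
    rw [Real.sin_sub]
    have e0 := Real.exp_pos (l 0).re
    have e1 := Real.exp_pos (l 1).re
    by_contra hcon
    push Not at hcon
    nlinarith [mul_nonneg (mul_pos e0 e1).le hcon]
  by_contra hcon
  push Not at hcon
  exact absurd (Real.sin_nonneg_of_nonneg_of_le_pi (sub_nonneg.2 hcon) (abs_lt.1 hlt).2.le)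
    (not_le.2 hsin)

lemma sixnd_tri (X Y : ℝ) (hX : 0 < X) (hY : 0 < Y) (hXY : X + Y < 2 * π) :
    Real.sin (X + Y) - Real.sin X - Real.sin Y < 0 := by
  have h1 : Real.sin (X + Y) - Real.sin X - Real.sin Y
      = - (4 * Real.sin (X / 2) * Real.sin (Y / 2) * Real.sin ((X + Y) / 2)) := by
    have eX : X = 2 * (X / 2) := by ring
    have eY : Y = 2 * (Y / 2) := by ring
    have eXY : (X + Y) / 2 = X / 2 + Y / 2 := by ring
    rw [eXY]
    generalize X / 2 = x at *
    generalize Y / 2 = y at *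
    subst eX eY
    rw [Real.sin_add, Real.sin_add, Real.sin_two_mul, Real.sin_two_mul, Real.cos_two_mul,
      Real.cos_two_mul]
    have hx := Real.sin_sq_add_cos_sq x
    have hy := Real.sin_sq_add_cos_sq y
    have hx' : Real.cos x ^ 2 = 1 - Real.sin x ^ 2 := by linarith
    have hy' : Real.cos y ^ 2 = 1 - Real.sin y ^ 2 := by linarith
    rw [hx', hy']
    ring
  rw [h1]
  have a1 : 0 < Real.sin (X / 2) := Real.sin_pos_of_pos_of_lt_pi (by linarith) (by linarith)
  have a2 : 0 < Real.sin (Y / 2) := Real.sin_pos_of_pos_of_lt_pi (by linarith) (by linarith)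
  have a3 : 0 < Real.sin ((X + Y) / 2) :=
    Real.sin_pos_of_pos_of_lt_pi (by linarith) (by linarith)
  have := mul_pos (mul_pos a1 a2) a3
  nlinarith

/-- The unit complex number of argument `x`. -/
def sixndE (x : ℝ) : ℂ := ⟨Real.cos x, Real.sin x⟩

lemma sixndE_add_two_pi (x : ℝ) : sixndE (x + 2 * π) = sixndE x := by
  simp [sixndE]

lemma sixndE_add_pi (x : ℝ) : sixndE (x + π) = - sixndE x := by
  apply Complex.ext <;> simp [sixndE]

lemma sixnd_normsq (x : ℝ) : Real.cos x * Real.cos x + Real.sin x * Real.sin x = 1 := by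
  have := Real.sin_sq_add_cos_sq x
  nlinarith

lemma sixnd_tri' (a b c : ℝ) (hab : a < b) (hbc : b < c) (hca : c < a + 2 * π) :
    ((sixndE c - sixndE b) * conj (sixndE a - sixndE b)).im < 0 := by
  have := sixnd_tri (c - b) (b - a) (by linarith) (by linarith) (by linarith)
  have e : c - b + (b - a) = c - a := by ring
  rw [e, Real.sin_sub, Real.sin_sub, Real.sin_sub] at this
  simp only [sixndE, Complex.mul_im, Complex.sub_re, Complex.sub_im, Complex.conj_re,
    Complex.conj_im]
  nlinarith [sixnd_normsq b]

lemma sixnd_half (b : ℝ) (z : ℂ) (hz : ‖z‖ ≤ 1) (hne : z ≠ sixndE b) :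
    0 < ((-conj (sixndE b)) * (z - sixndE b)).re := by
  have h1 : z.re * z.re + z.im * z.im ≤ 1 := by
    have : Complex.normSq z ≤ 1 := by
      rw [Complex.normSq_eq_norm_sq]
      nlinarith [norm_nonneg z]
    rwa [Complex.normSq_apply] at this
  have hb := sixnd_normsq b
  simp only [sixndE, Complex.mul_re, Complex.neg_re, Complex.neg_im, Complex.conj_re,
    Complex.conj_im, Complex.sub_re, Complex.sub_im]
  by_contra hcon
  push Not at hcon
  apply hne
  have h2 : (z.re - Real.cos b) ^ 2 + (z.im - Real.sin b) ^ 2 ≤ 0 := by nlinarith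
  have h3 : z.re - Real.cos b = 0 := by nlinarith [sq_nonneg (z.re - Real.cos b), sq_nonneg (z.im - Real.sin b)]
  have h4 : z.im - Real.sin b = 0 := by nlinarith [sq_nonneg (z.re - Real.cos b), sq_nonneg (z.im - Real.sin b)]
  apply Complex.ext
  · simp only [sixndE]; linarith
  · simp only [sixndE]; linarith

lemma sixnd_cross_disk (f g : ℝ → ℂ) (hf : Continuous f) (hg : Continuous g)
    (hf1 : ∀ s, ‖f s‖ ≤ 1) (hg1 : ∀ s, ‖g s‖ ≤ 1) (a b c d : ℝ)
    (hab : a < b) (hbc : b < c) (hcd : c < d) (hda : d < a + 2 * π)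
    (fa : f 0 = sixndE a) (fc : f 1 = sixndE c) (gb : g 0 = sixndE b) (gd : g 1 = sixndE d) :
    ∃ s t, f s = g t := by
  by_contra hne
  push Not at hne
  let F : C(ℝ × ℝ, ℂ) := ⟨fun p => f p.1 - g p.2, by fun_prop⟩
  have hF0 : ∀ p, F p ≠ 0 := fun p => sub_ne_zero.2 (hne _ _)
  obtain ⟨Λ, ⟨-, hΛ⟩, -⟩ := Complex.isCoveringMapOn_exp.existsUnique_continuousMap_lifts F
    (a₀ := (0, 0)) (e₀ := Complex.log (F (0, 0))) (Complex.exp_log (hF0 _)) (fun p => hF0 p)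
  have hΛ' : ∀ s t, Complex.exp (Λ (s, t)) = f s - g t := fun s t => congrFun hΛ (s, t)
  have s1 : (Λ (1, 0)).im < (Λ (0, 0)).im := by
    refine sixnd_step (fun s => Λ (s, 0)) (by fun_prop) (-conj (sixndE b)) ?_ ?_
    · intro s
      simp only [hΛ', gb]
      exact sixnd_half b _ (hf1 s) (by rw [← gb]; exact hne _ _)
    · simp only [hΛ', gb, fa, fc]
      exact sixnd_tri' a b c hab hbc (by linarith)
  have s2 : (Λ (1, 1)).im < (Λ (1, 0)).im := by
    refine sixnd_step (fun s => Λ (1, s)) (by fun_prop) (conj (sixndE c)) ?_ ?_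
    · intro s
      simp only [hΛ', fc]
      have := sixnd_half c _ (hg1 s) (by rw [← fc]; exact (hne _ _).symm)
      rwa [neg_mul, ← mul_neg, neg_sub] at this
    · simp only [hΛ', gb, fc, gd]
      have := sixnd_tri' b c d hbc hcd (by linarith)
      rw [← neg_sub, ← neg_sub (sixndE b), map_neg, neg_mul_neg]
      exact this
  have s3 : (Λ (0, 1)).im < (Λ (1, 1)).im := by
    have := sixnd_step (fun s => Λ (1 - s, 1)) (by fun_prop) (-conj (sixndE d)) ?_ ?_
    · simpa using this
    · intro s
      simp only [hΛ', gd]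
      exact sixnd_half d _ (hf1 _) (by rw [← gd]; exact hne _ _)
    · simp only [hΛ', gd, sub_zero, sub_self, fa, fc]
      rw [← sixndE_add_two_pi a]
      exact sixnd_tri' c d (a + 2 * π) hcd (by linarith) (by linarith)
  have s4 : (Λ (0, 0)).im < (Λ (0, 1)).im := by
    have := sixnd_step (fun s => Λ (0, 1 - s)) (by fun_prop) (conj (sixndE a)) ?_ ?_
    · simpa using this
    · intro s
      simp only [hΛ', fa]
      have := sixnd_half a _ (hg1 (1 - s)) (by rw [← fa]; exact (hne _ _).symm)
      rwa [neg_mul, ← mul_neg, neg_sub] at this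
    · simp only [hΛ', fa, sub_zero, sub_self, gb, gd]
      have := sixnd_tri' (d - 2 * π) a b (by linarith) hab (by linarith)
      rw [← sixndE_add_two_pi (d - 2 * π), sub_add_cancel] at this
      rw [← neg_sub, ← neg_sub (sixndE d), map_neg, neg_mul_neg]
      exact this
  linarith

/-- Unit vector of polar angle `x`. -/
def sixndV (x : ℝ) : ℝ × ℝ := (Real.cos x, Real.sin x)

/-- Boundary point of the star-shaped domain `Om` in direction `x`. -/
def sixndG (Om : Set (ℝ × ℝ)) (x : ℝ) : ℝ × ℝ := (gauge Om (sixndV x))⁻¹ • sixndV x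

/-- Euclidean norm squared. -/
def sixndN (p : ℝ × ℝ) : ℝ := p.1 ^ 2 + p.2 ^ 2

/-- Radial rescaling of `Om` to the unit disk. -/
def sixndPhi (Om : Set (ℝ × ℝ)) (p : ℝ × ℝ) : ℂ :=
  ((gauge Om p / ‖(⟨p.1, p.2⟩ : ℂ)‖ : ℝ) : ℂ) * ⟨p.1, p.2⟩

/-- Standing geometric assumptions. -/
structure SixGeo (Om : Set (ℝ × ℝ)) : Prop where
  hopen : IsOpen Om
  hconv : Convex ℝ Om
  h0 : (0 : ℝ × ℝ) ∈ Om
  hbdd : Bornology.IsBounded Om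
  hsymm : ∀ p ∈ Om, -p ∈ Om

lemma sixndV_ne (x : ℝ) : sixndV x ≠ 0 := by
  intro h
  have h1 : Real.cos x = 0 := congrArg Prod.fst h
  have h2 : Real.sin x = 0 := congrArg Prod.snd h
  have := Real.sin_sq_add_cos_sq x
  rw [h1, h2] at this
  norm_num at this

lemma sixndV_N (x : ℝ) : sixndN (sixndV x) = 1 := by
  have := Real.sin_sq_add_cos_sq x
  simp only [sixndN, sixndV]; linarith

lemma sixndN_smul (t : ℝ) (p : ℝ × ℝ) : sixndN (t • p) = t ^ 2 * sixndN p := by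
  simp [sixndN]; ring

lemma sixndN_neg (p : ℝ × ℝ) : sixndN (-p) = sixndN p := by simp [sixndN]

lemma sixndV_add_pi (x : ℝ) : sixndV (x + π) = - sixndV x := by simp [sixndV]

lemma sixnd_polar (p : ℝ × ℝ) : ∃ r x : ℝ, 0 ≤ r ∧ r ^ 2 = sixndN p ∧ p = r • sixndV x := by
  refine ⟨‖(⟨p.1, p.2⟩ : ℂ)‖, Complex.arg ⟨p.1, p.2⟩, norm_nonneg _, ?_, ?_⟩
  · rw [← Complex.normSq_eq_norm_sq, Complex.normSq_apply]; simp [sixndN]; ring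
  · have h1 := Complex.norm_mul_cos_arg ⟨p.1, p.2⟩
    have h2 := Complex.norm_mul_sin_arg ⟨p.1, p.2⟩
    ext
    · simp [sixndV]
    · simp [sixndV]

namespace SixGeo
lemma nhds0 {Om : Set (ℝ × ℝ)} (H : SixGeo Om) : Om ∈ nhds (0 : ℝ × ℝ) := H.hopen.mem_nhds H.h0

lemma gpos {Om : Set (ℝ × ℝ)} (H : SixGeo Om) {p : ℝ × ℝ} (hp : p ≠ 0) : 0 < gauge Om p :=
  (gauge_pos (absorbent_nhds_zero H.nhds0) ((NormedSpace.isVonNBounded_iff ℝ).2 H.hbdd)).2 hp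

lemma mem_iff {Om : Set (ℝ × ℝ)} (H : SixGeo Om) {p : ℝ × ℝ} : p ∈ Om ↔ gauge Om p < 1 := by
  rw [gauge_lt_one_iff_mem_interior H.hconv H.nhds0, H.hopen.interior_eq]

lemma front_iff {Om : Set (ℝ × ℝ)} (H : SixGeo Om) {p : ℝ × ℝ} : p ∈ frontier Om ↔ gauge Om p = 1 :=
  (gauge_eq_one_iff_mem_frontier H.hconv H.nhds0).symm

lemma clos_iff {Om : Set (ℝ × ℝ)} (H : SixGeo Om) {p : ℝ × ℝ} : p ∈ closure Om ↔ gauge Om p ≤ 1 :=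
  (gauge_le_one_iff_mem_closure H.hconv H.nhds0).symm

lemma gneg {Om : Set (ℝ × ℝ)} (H : SixGeo Om) (p : ℝ × ℝ) : gauge Om (-p) = gauge Om p := gauge_neg H.hsymm p

lemma gaugeG {Om : Set (ℝ × ℝ)} (H : SixGeo Om) (x : ℝ) : gauge Om (sixndG Om x) = 1 := by
  have := H.gpos (sixndV_ne x)
  rw [sixndG, gauge_smul_of_nonneg (inv_nonneg.2 this.le), smul_eq_mul, inv_mul_cancel₀ this.ne']

lemma frontG {Om : Set (ℝ × ℝ)} (H : SixGeo Om) (x : ℝ) : sixndG Om x ∈ frontier Om := H.front_iff.2 (H.gaugeG x)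

lemma G_add_pi {Om : Set (ℝ × ℝ)} (H : SixGeo Om) (x : ℝ) : sixndG Om (x + π) = - sixndG Om x := by
  rw [sixndG, sixndG, sixndV_add_pi, H.gneg, smul_neg]

lemma G_notmem {Om : Set (ℝ × ℝ)} (H : SixGeo Om) (x : ℝ) : sixndG Om x ∉ Om := by
  rw [H.mem_iff, H.gaugeG]; exact lt_irrefl _

lemma smulG_mem {Om : Set (ℝ × ℝ)} (H : SixGeo Om) (x t : ℝ) (h0 : 0 ≤ t) (h1 : t < 1) : t • sixndG Om x ∈ Om := by
  rw [H.mem_iff, gauge_smul_of_nonneg h0, H.gaugeG]; simpa using h1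

/-- Points of the frontier are of the form `sixndG Om x`. -/
lemma exists_G {Om : Set (ℝ × ℝ)} (H : SixGeo Om) {p : ℝ × ℝ} {r x : ℝ} (hp : p ∈ frontier Om) (hr : 0 ≤ r) (h : p = r • sixndV x) :
    p = sixndG Om x := by
  have h1 := H.front_iff.1 hp
  rw [h, gauge_smul_of_nonneg hr, smul_eq_mul] at h1
  have := H.gpos (sixndV_ne x)
  have h2 : r = (gauge Om (sixndV x))⁻¹ := by field_simp; linarith
  rw [h, sixndG, h2]

lemma Phi_norm {Om : Set (ℝ × ℝ)} (H : SixGeo Om) (p : ℝ × ℝ) : ‖sixndPhi Om p‖ = gauge Om p := by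
  by_cases hp : p = 0
  · subst hp; simp [sixndPhi]
  · have hz : (⟨p.1, p.2⟩ : ℂ) ≠ 0 := by
      intro h
      apply hp
      have h1 := congrArg Complex.re h
      have h2 := congrArg Complex.im h
      exact Prod.ext h1 h2
    have hz' : 0 < ‖(⟨p.1, p.2⟩ : ℂ)‖ := norm_pos_iff.2 hz
    rw [sixndPhi, norm_mul, Complex.norm_real, Real.norm_of_nonneg
      (div_nonneg (gauge_nonneg _) hz'.le), div_mul_cancel₀ _ hz'.ne']

lemma Phi_cont {Om : Set (ℝ × ℝ)} (H : SixGeo Om) : Continuous (sixndPhi Om) := by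
  have hz : Continuous fun p : ℝ × ℝ => (⟨p.1, p.2⟩ : ℂ) :=
    Complex.equivRealProdCLM.symm.continuous
  have hg : Continuous (gauge Om) := continuous_gauge H.hconv H.nhds0
  rw [continuous_iff_continuousAt]
  intro p
  by_cases hp : p = 0
  · subst hp
    have h0 : sixndPhi Om 0 = 0 := by
      rw [← norm_eq_zero, H.Phi_norm]; simp
    rw [ContinuousAt, h0, tendsto_zero_iff_norm_tendsto_zero]
    simp only [H.Phi_norm]
    have := hg.tendsto 0
    simpa using this
  · have hz' : ‖(⟨p.1, p.2⟩ : ℂ)‖ ≠ 0 := by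
      rw [norm_ne_zero_iff]
      intro h
      apply hp
      have h1 := congrArg Complex.re h
      have h2 := congrArg Complex.im h
      exact Prod.ext h1 h2
    unfold sixndPhi
    exact (Complex.continuous_ofReal.continuousAt.comp
      (hg.continuousAt.div hz.norm.continuousAt hz')).mul hz.continuousAt

lemma Phi_inj {Om : Set (ℝ × ℝ)} (H : SixGeo Om) {p q : ℝ × ℝ} (h : sixndPhi Om p = sixndPhi Om q) : p = q := by
  have hn : gauge Om p = gauge Om q := by rw [← H.Phi_norm, ← H.Phi_norm, h]
  by_cases hp : p = 0
  · subst hp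
    by_contra hq
    have := H.gpos (Ne.symm hq)
    rw [← hn] at this
    simp at this
  · have hq : q ≠ 0 := by
      rintro rfl
      have := H.gpos hp
      rw [hn] at this
      simp at this
    have aux : ∀ p : ℝ × ℝ, p ≠ 0 → 0 < ‖(⟨p.1, p.2⟩ : ℂ)‖ := by
      intro p hp
      rw [norm_pos_iff]
      intro h
      apply hp
      have h1 := congrArg Complex.re h
      have h2 := congrArg Complex.im h
      exact Prod.ext h1 h2
    have e1 := congrArg Complex.re h
    have e2 := congrArg Complex.im h
    simp only [sixndPhi, Complex.re_ofReal_mul, Complex.im_ofReal_mul] at e1 e2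
    set a := gauge Om p / ‖(⟨p.1, p.2⟩ : ℂ)‖
    set b := gauge Om q / ‖(⟨q.1, q.2⟩ : ℂ)‖
    have ha : 0 < a := div_pos (H.gpos hp) (aux p hp)
    have hb : 0 < b := div_pos (H.gpos hq) (aux q hq)
    have e : a • p = b • q := Prod.ext e1 e2
    have e3 := congrArg (gauge Om) e
    rw [gauge_smul_of_nonneg ha.le, gauge_smul_of_nonneg hb.le, hn] at e3
    have hab : a = b := mul_right_cancel₀ (H.gpos hq).ne' e3
    rw [← hab] at e
    exact smul_right_injective _ ha.ne' e

lemma Phi_G {Om : Set (ℝ × ℝ)} (H : SixGeo Om) (x : ℝ) : sixndPhi Om (sixndG Om x) = sixndE x := by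
  have hk := inv_pos.2 (H.gpos (sixndV_ne x))
  have hg := H.gaugeG x
  rw [sixndPhi, hg]
  have e : (⟨(sixndG Om x).1, (sixndG Om x).2⟩ : ℂ)
      = (((gauge Om (sixndV x))⁻¹ : ℝ) : ℂ) * sixndE x := by
    apply Complex.ext
    · rw [Complex.re_ofReal_mul]; rfl
    · rw [Complex.im_ofReal_mul]; rfl
  have hE : ‖sixndE x‖ = 1 := by
    have : sixndE x = Complex.exp (x * Complex.I) := by
      apply Complex.ext
      · rw [Complex.exp_ofReal_mul_I_re]; rfl
      · rw [Complex.exp_ofReal_mul_I_im]; rfl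
    rw [this, Complex.norm_exp_ofReal_mul_I]
  rw [e, norm_mul, hE, mul_one, Complex.norm_real, Real.norm_of_nonneg hk.le, ← mul_assoc,
    ← Complex.ofReal_mul]
  rw [one_div, inv_mul_cancel₀ hk.ne']
  simp

lemma G_ne {Om : Set (ℝ × ℝ)} (H : SixGeo Om) {a b : ℝ} (hab : a < b) (hb : b < a + 2 * π) : sixndG Om a ≠ sixndG Om b := by
  intro h
  have h1 : sixndE a = sixndE b := by rw [← H.Phi_G, ← H.Phi_G, h]
  have h2 : Real.cos a = Real.cos b := by
    have := congrArg Complex.re h1; rwa [sixndE, sixndE] at this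
  have h3 : Real.sin a = Real.sin b := by
    have := congrArg Complex.im h1; rwa [sixndE, sixndE] at this
  have h4 : Real.cos (b - a) = 1 := by
    rw [Real.cos_sub, h2, h3]; exact sixnd_normsq b
  have := (Real.cos_eq_one_iff_of_lt_of_lt (by linarith) (by linarith)).1 h4
  linarith

lemma cross {Om : Set (ℝ × ℝ)} (H : SixGeo Om) {S T : Set (ℝ × ℝ)} (hS : S ⊆ closure Om) (hT : T ⊆ closure Om) {a b c d : ℝ}
    (hab : a < b) (hbc : b < c) (hcd : c < d) (hda : d < a + 2 * π)
    (j1 : JoinedIn S (sixndG Om a) (sixndG Om c))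
    (j2 : JoinedIn T (sixndG Om b) (sixndG Om d)) : (S ∩ T).Nonempty := by
  obtain ⟨f, hf⟩ := j1
  obtain ⟨g, hg⟩ := j2
  have hmem1 : ∀ s, f.extend s ∈ S := fun s => by
    simpa [Path.extend, Set.IccExtend] using hf _
  have hmem2 : ∀ s, g.extend s ∈ T := fun s => by
    simpa [Path.extend, Set.IccExtend] using hg _
  obtain ⟨s, t, hst⟩ := sixnd_cross_disk (fun s => sixndPhi Om (f.extend s))
    (fun s => sixndPhi Om (g.extend s)) (H.Phi_cont.comp f.continuous_extend)
    (H.Phi_cont.comp g.continuous_extend)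
    (fun s => by rw [H.Phi_norm]; exact H.clos_iff.1 (hS (hmem1 s)))
    (fun s => by rw [H.Phi_norm]; exact H.clos_iff.1 (hT (hmem2 s))) a b c d hab hbc hcd hda
    (by simp [H.Phi_G]) (by simp [H.Phi_G]) (by simp [H.Phi_G]) (by simp [H.Phi_G])
  have e := H.Phi_inj hst
  exact ⟨f.extend s, hmem1 s, e ▸ hmem2 t⟩

end SixGeo

/-- The nonvanishing set of `u` in `Om`. -/
def sixndS (Om : Set (ℝ × ℝ)) (u : ℝ × ℝ → ℝ) : Set (ℝ × ℝ) := {q | q ∈ Om ∧ u q ≠ 0}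

/-- `K` is a nodal domain. -/
def SixComp (Om : Set (ℝ × ℝ)) (u : ℝ × ℝ → ℝ) (K : Set (ℝ × ℝ)) : Prop :=
  ∃ p : ℝ × ℝ, p ∈ Om ∧ u p ≠ 0 ∧ K = connectedComponentIn (sixndS Om u) p

/-- `K` is a nodal domain attached at the boundary point in direction `x`. -/
def SixAtt (Om : Set (ℝ × ℝ)) (u : ℝ × ℝ → ℝ) (x : ℝ) (K : Set (ℝ × ℝ)) : Prop :=
  SixComp Om u K ∧ ∃ t0 : ℝ, 0 < t0 ∧ t0 < 1 ∧ ∀ t, 0 < t → t ≤ t0 → (1 - t) • sixndG Om x ∈ K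

/-- Data for the topological part of the argument. -/
structure SixData (Om : Set (ℝ × ℝ)) (u : ℝ × ℝ → ℝ) (Ψ : ℝ → ℝ) : Prop extends SixGeo Om where
  hu : ContinuousOn u Om
  heven : ∀ p ∈ Om, u (-p) = u p
  hcircle : ∀ r x0 : ℝ, (∀ x, r • sixndV x ∈ Om) → u (r • sixndV x0) ≠ 0 →
    ∃ x, u (r • sixndV x) * u (r • sixndV x0) < 0
  hΨ : ∀ x, Ψ x ≠ 0 → ∃ t0 : ℝ, 0 < t0 ∧ t0 < 1 ∧
    ∀ t, 0 < t → t ≤ t0 → 0 < Ψ x * u ((1 - t) • sixndG Om x)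
  hper : ∀ x, Ψ (x + π) = Ψ x
  hmin : ∀ x, (∀ y, sixndN (sixndG Om x) ≤ sixndN (sixndG Om y)) → Ψ x = 0

namespace SixData
variable {Om : Set (ℝ × ℝ)} {u : ℝ × ℝ → ℝ} {Ψ : ℝ → ℝ}

lemma openS (H : SixData Om u Ψ) : IsOpen (sixndS Om u) :=
  H.hu.isOpen_inter_preimage H.hopen isOpen_ne

lemma comp_sub {K : Set (ℝ × ℝ)} (hK : SixComp Om u K) : K ⊆ sixndS Om u := by
  obtain ⟨p, -, -, rfl⟩ := hK
  exact connectedComponentIn_subset _ _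

lemma comp_precon {K : Set (ℝ × ℝ)} (hK : SixComp Om u K) : IsPreconnected K := by
  obtain ⟨p, -, -, rfl⟩ := hK
  exact isPreconnected_connectedComponentIn

lemma comp_eq {K : Set (ℝ × ℝ)} (hK : SixComp Om u K) {q : ℝ × ℝ} (hq : q ∈ K) :
    K = connectedComponentIn (sixndS Om u) q := by
  obtain ⟨p, -, -, rfl⟩ := hK
  exact connectedComponentIn_eq hq

lemma comp_uniq {K K' : Set (ℝ × ℝ)} (hK : SixComp Om u K) (hK' : SixComp Om u K') {q : ℝ × ℝ}
    (hq : q ∈ K) (hq' : q ∈ K') : K = K' := by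
  rw [comp_eq hK hq, ← comp_eq hK' hq']

lemma comp_pathcon (H : SixData Om u Ψ) {K : Set (ℝ × ℝ)} (hK : SixComp Om u K) :
    IsPathConnected K := by
  obtain ⟨p, hp, hup, rfl⟩ := hK
  rw [← (H.openS.connectedComponentIn).isConnected_iff_isPathConnected]
  exact isConnected_connectedComponentIn_iff.2 ⟨hp, hup⟩

lemma comp_sign (H : SixData Om u Ψ) {K : Set (ℝ × ℝ)} (hK : SixComp Om u K) {p q : ℝ × ℝ}
    (hp : p ∈ K) (hq : q ∈ K) : 0 < u p * u q := by
  by_contra hcon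
  push Not at hcon
  have hcont : ContinuousOn u K := H.hu.mono fun x hx => (comp_sub hK hx).1
  have h0 : (0 : ℝ) ∈ u '' K := by
    have hpre := ((comp_precon hK).image u hcont).ordConnected
    rcases le_total (u p) 0 with h | h
    · rcases le_total (u q) 0 with h' | h'
      · rcases mul_eq_zero.1 (le_antisymm hcon (mul_nonneg_of_nonpos_of_nonpos h h')) with h | h
        · exact ⟨p, hp, h⟩
        · exact ⟨q, hq, h⟩
      · exact hpre.out ⟨p, hp, rfl⟩ ⟨q, hq, rfl⟩ ⟨h, h'⟩
    · rcases le_total (u q) 0 with h' | h'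
      · exact hpre.out ⟨q, hq, rfl⟩ ⟨p, hp, rfl⟩ ⟨h', h⟩
      · rcases mul_eq_zero.1 (le_antisymm hcon (mul_nonneg h h')) with h | h
        · exact ⟨p, hp, h⟩
        · exact ⟨q, hq, h⟩
  obtain ⟨x, hx, hx0⟩ := h0
  exact (comp_sub hK hx).2 hx0

lemma exists_att (H : SixData Om u Ψ) {x : ℝ} (hx : Ψ x ≠ 0) : ∃ K, SixAtt Om u x K := by
  obtain ⟨t0, h0, h1, h⟩ := H.hΨ x hx
  have hmem : ∀ t, 0 < t → t ≤ t0 → (1 - t) • sixndG Om x ∈ sixndS Om u := by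
    intro t ht htt
    refine ⟨H.smulG_mem x _ (by linarith) (by linarith), ?_⟩
    intro hu0
    have := h t ht htt
    rw [hu0, mul_zero] at this
    exact lt_irrefl _ this
  have hm0 := hmem t0 h0 le_rfl
  refine ⟨_, ⟨_, hm0.1, hm0.2, rfl⟩, t0, h0, h1, ?_⟩
  have hc : IsPreconnected ((fun t : ℝ => (1 - t) • sixndG Om x) '' Set.Ioc 0 t0) :=
    isPreconnected_Ioc.image _ (by fun_prop)
  have hsub := hc.subset_connectedComponentIn (x := (1 - t0) • sixndG Om x) (F := sixndS Om u)
    ⟨t0, ⟨h0, le_rfl⟩, rfl⟩ (by rintro _ ⟨t, ht, rfl⟩; exact hmem t ht.1 ht.2)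
  exact fun t ht htt => hsub ⟨t, ⟨ht, htt⟩, rfl⟩

lemma att_uniq {x : ℝ} {K K' : Set (ℝ × ℝ)} (h : SixAtt Om u x K) (h' : SixAtt Om u x K') :
    K = K' := by
  obtain ⟨hK, t, ht, -, hm⟩ := h
  obtain ⟨hK', t', ht', -, hm'⟩ := h'
  exact comp_uniq hK hK' (hm (min t t') (lt_min ht ht') (min_le_left _ _))
    (hm' (min t t') (lt_min ht ht') (min_le_right _ _))

lemma att_sign (H : SixData Om u Ψ) {x : ℝ} (hx : Ψ x ≠ 0) {K : Set (ℝ × ℝ)}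
    (h : SixAtt Om u x K) {q : ℝ × ℝ} (hq : q ∈ K) : 0 < Ψ x * u q := by
  obtain ⟨hK, t, ht, -, hm⟩ := h
  obtain ⟨t', ht', -, hm'⟩ := H.hΨ x hx
  have h1 := hm (min t t') (lt_min ht ht') (min_le_left _ _)
  have h2 := hm' (min t t') (lt_min ht ht') (min_le_right _ _)
  have h3 := H.comp_sign hK h1 hq
  have h4 := mul_pos h2 h3
  have h5 : 0 < (u ((1 - min t t') • sixndG Om x)) ^ 2 := by
    have := (comp_sub hK h1).2
    positivity
  by_contra hcon
  push Not at hcon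
  nlinarith

lemma comp_neg (H : SixData Om u Ψ) {K : Set (ℝ × ℝ)} (h : SixComp Om u K) :
    SixComp Om u (Neg.neg '' K) := by
  obtain ⟨p, hp, hup, rfl⟩ := h
  refine ⟨-p, H.hsymm p hp, by rwa [H.heven p hp], ?_⟩
  have := (Homeomorph.neg (ℝ × ℝ)).image_connectedComponentIn (s := sixndS Om u) (x := p) ⟨hp, hup⟩
  have e : (Homeomorph.neg (ℝ × ℝ)) '' sixndS Om u = sixndS Om u := by
    ext q
    constructor
    · rintro ⟨q, hq, rfl⟩
      exact ⟨H.hsymm q hq.1, by simpa [H.heven q hq.1] using hq.2⟩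
    · intro hq
      exact ⟨-q, ⟨H.hsymm q hq.1, by simpa [H.heven q hq.1] using hq.2⟩, by simp⟩
  rw [e] at this
  exact this

lemma att_neg (H : SixData Om u Ψ) {x : ℝ} {K : Set (ℝ × ℝ)} (h : SixAtt Om u x K) :
    SixAtt Om u (x + π) (Neg.neg '' K) := by
  obtain ⟨hK, t, ht, ht1, hm⟩ := h
  refine ⟨H.comp_neg hK, t, ht, ht1, fun s hs hst => ⟨_, hm s hs hst, ?_⟩⟩
  rw [H.G_add_pi, smul_neg]

lemma neg_neg_im (K : Set (ℝ × ℝ)) : Neg.neg '' (Neg.neg '' K) = K := by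
  simp [Set.image_neg_eq_neg]

/-- From the boundary point into the domain. -/
lemma att_join (H : SixData Om u Ψ) {x : ℝ} {K : Set (ℝ × ℝ)} (h : SixAtt Om u x K) {q : ℝ × ℝ}
    (hq : q ∈ K) : JoinedIn (insert (sixndG Om x) K) (sixndG Om x) q := by
  obtain ⟨hK, t, ht, ht1, hm⟩ := h
  have j1 : JoinedIn (insert (sixndG Om x) K) (sixndG Om x) ((1 - t) • sixndG Om x) := by
    refine JoinedIn.ofLine (f := fun s : ℝ => (1 - t * s) • sixndG Om x) (by fun_prop) (by simp)
      (by simp) ?_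
    rintro _ ⟨s, hs, rfl⟩
    rcases hs.1.eq_or_lt with h0 | h0
    · left; simp [← h0]
    · right; exact hm _ (by positivity) (by nlinarith [hs.2])
  exact j1.trans (((H.comp_pathcon hK).joinedIn _ (hm t ht le_rfl) _ hq).mono
    (Set.subset_insert _ _))

lemma att_join2 (H : SixData Om u Ψ) {x y : ℝ} {K : Set (ℝ × ℝ)} (h : SixAtt Om u x K)
    (h' : SixAtt Om u y K) :
    JoinedIn (insert (sixndG Om x) (insert (sixndG Om y) K)) (sixndG Om x) (sixndG Om y) := by
  obtain ⟨hK, t, ht, ht1, hm⟩ := id h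
  have := hm t ht le_rfl
  refine ((H.att_join h this).mono ?_).trans ((H.att_join h' this).symm.mono ?_)
  · exact Set.insert_subset_insert (Set.subset_insert _ _)
  · exact Set.subset_insert _ _

lemma comp_clos {K : Set (ℝ × ℝ)} (hK : SixComp Om u K) : K ⊆ closure Om :=
  fun _ hq => subset_closure (comp_sub hK hq).1

lemma att_clos (H : SixData Om u Ψ) {x y : ℝ} {K : Set (ℝ × ℝ)} (hK : SixComp Om u K) :
    (insert (sixndG Om x) (insert (sixndG Om y) K)) ⊆ closure Om := by
  intro q hq
  rcases hq with rfl | rfl | hq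
  · exact frontier_subset_closure (H.frontG _)
  · exact frontier_subset_closure (H.frontG _)
  · exact comp_clos hK hq

lemma att_cross (H : SixData Om u Ψ) {a b c d : ℝ} {K K' : Set (ℝ × ℝ)}
    (hab : a < b) (hbc : b < c) (hcd : c < d) (hda : d < a + 2 * π)
    (ha : SixAtt Om u a K) (hc : SixAtt Om u c K) (hb : SixAtt Om u b K')
    (hd : SixAtt Om u d K') : K = K' := by
  obtain ⟨q, h1, h2⟩ := H.cross (H.att_clos ha.1) (H.att_clos hb.1) hab hbc hcd hda
    (H.att_join2 ha hc) (H.att_join2 hb hd)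
  have nK : ∀ x, sixndG Om x ∉ K := fun x hx => H.G_notmem x (comp_sub ha.1 hx).1
  have nK' : ∀ x, sixndG Om x ∉ K' := fun x hx => H.G_notmem x (comp_sub hb.1 hx).1
  have e1 := H.G_ne hab (by linarith)
  have e2 := H.G_ne (hab.trans (hbc.trans hcd)) hda
  have e3 := H.G_ne hbc (by linarith)
  have e4 := H.G_ne hcd (by linarith)
  rcases h1 with rfl | rfl | h1
  · rcases h2 with h2 | h2 | h2
    · exact absurd h2 e1
    · exact absurd h2 e2
    · exact absurd h2 (nK' _)
  · rcases h2 with h2 | h2 | h2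
    · exact absurd h2.symm e3
    · exact absurd h2 e4
    · exact absurd h2 (nK' _)
  · rcases h2 with rfl | rfl | h2
    · exact absurd h1 (nK _)
    · exact absurd h1 (nK _)
    · exact comp_uniq ha.1 hb.1 h1 h2

end SixData

lemma sixnd_sgn {x y z w : ℝ} (h1 : 0 < x * y) (h2 : y * z < 0) (h3 : 0 < w * z) : x * w < 0 := by
  rcases mul_pos_iff.1 h1 with ⟨a, b⟩ | ⟨a, b⟩ <;> rcases mul_pos_iff.1 h3 with ⟨c, d⟩ | ⟨c, d⟩ <;>
    nlinarith

lemma sixnd_sgn2 {A B z : ℝ} (h1 : 0 < A * z) (h2 : 0 < B * z) (h3 : B * A < 0) : False := by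
  nlinarith [mul_pos h1 h2, sq_nonneg z]

lemma sixndN_cont : Continuous sixndN := by unfold sixndN; fun_prop

namespace SixData
variable {Om : Set (ℝ × ℝ)} {u : ℝ × ℝ → ℝ} {Ψ : ℝ → ℝ}

lemma exists_min (H : SixData Om u Ψ) (a : ℝ) :
    ∃ x, a ≤ x ∧ x < a + π ∧ ∀ y, sixndN (sixndG Om x) ≤ sixndN (sixndG Om y) := by
  have hc : IsCompact (frontier Om) := by
    have h1 : IsCompact (closure Om) := H.hbdd.isCompact_closure
    exact h1.of_isClosed_subset isClosed_frontier frontier_subset_closure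
  obtain ⟨z, hz, hmin⟩ := hc.exists_isMinOn ⟨_, H.frontG 0⟩ sixndN_cont.continuousOn
  obtain ⟨r, x, hr, -, hx⟩ := sixnd_polar z
  have hzG := H.exists_G hz hr hx
  have hp : Function.Periodic (fun x => sixndN (sixndG Om x)) π := by
    intro x; simp only [H.G_add_pi, sixndN_neg]
  obtain ⟨y, hy, hxy⟩ := hp.exists_mem_Ico pi_pos x a
  refine ⟨y, hy.1, hy.2, fun w => ?_⟩
  have h1 := hmin (H.frontG w)
  have h2 : sixndN (sixndG Om x) = sixndN (sixndG Om y) := hxy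
  rw [← h2, ← hzG]
  exact h1

lemma enclose (H : SixData Om u Ψ) {a : ℝ} (ha : Ψ a ≠ 0) {K : Set (ℝ × ℝ)}
    (h1 : SixAtt Om u a K) (h2 : SixAtt Om u (a + π) K) :
    ∃ E, SixComp Om u E ∧ (∀ q ∈ E, u q * Ψ a < 0) ∧
      ∀ y, a < y → y < a + π → Ψ y * Ψ a < 0 → ∀ K', SixAtt Om u y K' →
        E ≠ K' ∧ E ≠ Neg.neg '' K' := by
  obtain ⟨f, hf⟩ := H.att_join2 h1 h2
  have hpi := pi_pos
  have hFsub : Set.range f ⊆ insert (sixndG Om a) (insert (sixndG Om (a + π)) K) := by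
    rintro _ ⟨t, rfl⟩; exact hf t
  have hFcl : Set.range f ⊆ closure Om := hFsub.trans (H.att_clos h1.1)
  have hFj : JoinedIn (Set.range f) (sixndG Om a) (sixndG Om (a + π)) :=
    ⟨f, fun t => ⟨t, rfl⟩⟩
  have hFc : IsCompact (Set.range f) := isCompact_range f.continuous
  obtain ⟨p0, hp0F, hp0min⟩ := hFc.exists_isMinOn (Set.range_nonempty f) sixndN_cont.continuousOn
  have hp0min' : ∀ q ∈ Set.range f, sixndN p0 ≤ sixndN q := fun q hq => hp0min hq
  obtain ⟨xm, hxa, hxb, hxm⟩ := H.exists_min a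
  have hxne : xm ≠ a := fun h => ha (h ▸ H.hmin xm hxm)
  have hxa' : a < xm := lt_of_le_of_ne hxa hxne.symm
  have hNpos : 0 < sixndN (sixndG Om xm) := by
    rw [sixndG, sixndN_smul, sixndV_N, mul_one]
    have := inv_pos.2 (H.gpos (sixndV_ne xm))
    positivity
  have hlt : sixndN p0 < sixndN (sixndG Om xm) := by
    by_contra hcon
    push Not at hcon
    have hT : (fun t : ℝ => t • sixndG Om xm) '' Set.Icc (-1) 1 ⊆ closure Om := by
      rintro _ ⟨t, ht, rfl⟩
      rw [H.clos_iff]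
      rcases le_total 0 t with h | h
      · simp only [gauge_smul_of_nonneg h, H.gaugeG]; simpa using ht.2
      · simp only
        rw [← H.gneg, ← neg_smul, gauge_smul_of_nonneg (by linarith), H.gaugeG]
        simp only [smul_eq_mul, mul_one]; linarith [ht.1]
    have jT : JoinedIn ((fun t : ℝ => t • sixndG Om xm) '' Set.Icc (-1) 1) (sixndG Om xm)
        (sixndG Om (xm + π)) := by
      refine JoinedIn.ofLine (f := fun s : ℝ => (1 - 2 * s) • sixndG Om xm) (by fun_prop) (by simp)
        ?_ ?_
      · rw [H.G_add_pi]; norm_num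
      · rintro _ ⟨s, hs, rfl⟩
        exact ⟨1 - 2 * s, ⟨by linarith [hs.2], by linarith [hs.1]⟩, rfl⟩
    obtain ⟨q, hqF, t, ht, rfl⟩ := H.cross hFcl hT hxa' hxb (by linarith : a + π < xm + π)
      (by linarith) hFj jT
    have h3 := hp0min' _ hqF
    simp only [sixndN_smul] at h3
    have h4 : 1 ≤ t ^ 2 := by nlinarith
    have h5 : t = 1 ∨ t = -1 := by
      have : t ^ 2 = 1 := le_antisymm (by nlinarith [ht.1, ht.2]) h4
      simpa using this
    have hq : (fun t : ℝ => t • sixndG Om xm) t = sixndG Om xm ∨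
        (fun t : ℝ => t • sixndG Om xm) t = sixndG Om (xm + π) := by
      rcases h5 with rfl | rfl
      · left; simp
      · right; simp [H.G_add_pi]
    have e1 := H.G_ne hxa' (by linarith)
    have e2 := H.G_ne (by linarith : a < xm + π) (by linarith)
    have e3 := H.G_ne hxb (by linarith)
    have e4 := H.G_ne (by linarith : a + π < xm + π) (by linarith)
    have hn : ∀ x, sixndG Om x ∉ K := fun x hx => H.G_notmem x (comp_sub h1.1 hx).1
    rcases hq with hq | hq <;> rw [hq] at hqF <;> rcases hFsub hqF with h | h | h
    · exact e1 h.symm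
    · exact e3 h
    · exact hn _ h
    · exact e2 h.symm
    · exact e4 h.symm
    · exact hn _ h
  obtain ⟨r, x0, hr, hr2, hp0⟩ := sixnd_polar p0
  have hcirc : ∀ x, r • sixndV x ∈ Om := by
    intro x
    have h3 := hlt.trans_le (hxm x)
    have hg := H.gpos (sixndV_ne x)
    rw [sixndG, sixndN_smul, sixndV_N, mul_one, ← hr2] at h3
    have h4 : r < (gauge Om (sixndV x))⁻¹ := lt_of_pow_lt_pow_left₀ 2 (by positivity) h3
    rw [H.mem_iff, gauge_smul_of_nonneg hr, smul_eq_mul]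
    calc r * gauge Om (sixndV x) < (gauge Om (sixndV x))⁻¹ * gauge Om (sixndV x) :=
          mul_lt_mul_of_pos_right h4 hg
      _ = 1 := inv_mul_cancel₀ hg.ne'
  have hp0K : p0 ∈ K := by
    have hO : p0 ∈ Om := hp0 ▸ hcirc x0
    rcases hFsub hp0F with h | h | h
    · exact absurd (h ▸ hO) (H.G_notmem _)
    · exact absurd (h ▸ hO) (H.G_notmem _)
    · exact h
  have hup0 := (comp_sub h1.1 hp0K).2
  obtain ⟨x, hx⟩ := H.hcircle r x0 hcirc (hp0 ▸ hup0)
  rw [← hp0] at hx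
  have hrpos : 0 < r := by
    rcases hr.eq_or_lt with h | h
    · exfalso
      rw [← h, zero_smul] at hx hp0
      rw [hp0] at hx
      nlinarith [mul_self_nonneg (u 0)]
    · exact h
  obtain ⟨t, ht0, ht1, htu⟩ : ∃ t : ℝ, 0 < t ∧ t < 1 ∧ u (t • r • sixndV x) * u p0 < 0 := by
    have hcont : ContinuousAt (fun t : ℝ => u (t • r • sixndV x) * u p0) 1 := by
      refine ContinuousAt.mul ?_ continuousAt_const
      refine ContinuousAt.comp (f := fun t : ℝ => t • r • sixndV x) ?_ (by fun_prop)
      rw [one_smul]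
      exact H.hu.continuousAt (H.hopen.mem_nhds (hcirc x))
    have hev := hcont.eventually_lt (continuousAt_const (y := (0 : ℝ))) (by simpa using hx)
    have hev2 : ∀ᶠ t in nhdsWithin (1 : ℝ) (Set.Iio 1), 0 < t ∧ t < 1 ∧
        u (t • r • sixndV x) * u p0 < 0 := by
      have h3 : ∀ᶠ t in nhdsWithin (1 : ℝ) (Set.Iio 1), t ∈ Set.Ioo (0 : ℝ) 1 :=
        Ioo_mem_nhdsLT (by norm_num)
      filter_upwards [h3, hev.filter_mono nhdsWithin_le_nhds] with t h4 h5
      exact ⟨h4.1, h4.2, h5⟩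
    exact hev2.exists
  set q' := t • r • sixndV x with hq'
  have hq'Om : q' ∈ Om := by
    have := H.hconv H.h0 (hcirc x) (a := 1 - t) (b := t) (by linarith) ht0.le (by ring)
    simpa using this
  have hq'u : u q' ≠ 0 := by
    intro h; rw [h, zero_mul] at htu; exact lt_irrefl _ htu
  have hq'N : sixndN q' < sixndN p0 := by
    rw [hq', sixndN_smul, sixndN_smul, sixndV_N, ← hr2]
    have : t ^ 2 < 1 := by nlinarith
    nlinarith [pow_pos hrpos 2]
  have hE : SixComp Om u (connectedComponentIn (sixndS Om u) q') := ⟨q', hq'Om, hq'u, rfl⟩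
  have hq'E : q' ∈ connectedComponentIn (sixndS Om u) q' :=
    mem_connectedComponentIn ⟨hq'Om, hq'u⟩
  refine ⟨_, hE, ?_, ?_⟩
  · intro e he
    exact sixnd_sgn (H.comp_sign hE he hq'E) htu (H.att_sign ha h1 hp0K)
  · intro y hay hya hyΨ K' hK'
    have key : ∀ q ∈ K', sixndN q < sixndN p0 → False := by
      intro q hqK hqN
      have hΨy : Ψ y ≠ 0 := by intro h; rw [h, zero_mul] at hyΨ; exact lt_irrefl _ hyΨ
      have hqO := (comp_sub hK'.1 hqK).1
      have hn := H.att_neg hK'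
      set B := {z : ℝ × ℝ | sixndN z < sixndN p0 ∧ z ∈ closure Om} with hB
      set T := insert (sixndG Om y) (insert (sixndG Om (y + π)) (K' ∪ Neg.neg '' K' ∪ B)) with hT
      have hTc : T ⊆ closure Om := by
        rintro z (rfl | rfl | (hz | hz) | hz)
        · exact frontier_subset_closure (H.frontG _)
        · exact frontier_subset_closure (H.frontG _)
        · exact comp_clos hK'.1 hz
        · exact comp_clos hn.1 hz
        · exact hz.2
      have j1 : JoinedIn T (sixndG Om y) q := (H.att_join hK' hqK).mono (by
        rintro z (rfl | hz)
        · left; rfl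
        · right; right; left; left; exact hz)
      have j3 : JoinedIn T (-q) (sixndG Om (y + π)) :=
        (H.att_join hn ⟨q, hqK, rfl⟩).symm.mono (by
        rintro z (rfl | hz)
        · right; left; rfl
        · right; right; left; right; exact hz)
      have j2 : JoinedIn T q (-q) := by
        refine JoinedIn.ofLine (f := fun s : ℝ => (1 - 2 * s) • q) (by fun_prop) (by simp)
          (by norm_num) ?_
        rintro _ ⟨s, hs, rfl⟩
        right; right; right
        refine ⟨?_, subset_closure ?_⟩
        · rw [sixndN_smul]
          have h3 : (1 - 2 * s) ^ 2 ≤ 1 := by nlinarith [hs.1, hs.2]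
          have h4 : 0 ≤ sixndN q := by simp only [sixndN]; positivity
          nlinarith
        · have := H.hconv hqO (H.hsymm q hqO) (a := 1 - s) (b := s) (by linarith [hs.2]) hs.1
            (by ring)
          convert this using 1
          rw [smul_neg, ← sub_eq_add_neg, ← sub_smul]; ring_nf
      obtain ⟨z, hzF, hzT⟩ := H.cross hFcl hTc hay hya (by linarith : a + π < y + π)
        (by linarith) hFj (j1.trans (j2.trans j3))
      have hnK : ∀ x, sixndG Om x ∉ K := fun x hx => H.G_notmem x (comp_sub h1.1 hx).1
      have hnK' : ∀ x, sixndG Om x ∉ K' := fun x hx => H.G_notmem x (comp_sub hK'.1 hx).1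
      have hnK2 : ∀ x, sixndG Om x ∉ Neg.neg '' K' :=
        fun x hx => H.G_notmem x (comp_sub hn.1 hx).1
      have e1 := H.G_ne hay (by linarith)
      have e2 := H.G_ne (by linarith : a < y + π) (by linarith)
      have e3 := H.G_ne hya (by linarith)
      have e4 := H.G_ne (by linarith : a + π < y + π) (by linarith)
      have hzF' := hFsub hzF
      rcases hzT with rfl | rfl | (hz | hz) | hz
      · rcases hzF' with h | h | h
        · exact e1 h.symm
        · exact e3 h
        · exact hnK _ h
      · rcases hzF' with h | h | h
        · exact e2 h.symm
        · exact e4 h.symm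
        · exact hnK _ h
      · rcases hzF' with rfl | rfl | h
        · exact hnK' _ hz
        · exact hnK' _ hz
        · have s1 := H.att_sign ha h1 h
          have s2 := H.att_sign hΨy hK' hz
          exact sixnd_sgn2 s1 s2 hyΨ
      · rcases hzF' with rfl | rfl | h
        · exact hnK2 _ hz
        · exact hnK2 _ hz
        · have s1 := H.att_sign ha h1 h
          have s2 := H.att_sign (by rwa [H.hper]) hn hz
          rw [H.hper] at s2
          exact sixnd_sgn2 s1 s2 hyΨ
      · exact absurd (hp0min' _ hzF) (not_le.2 hz.1)
    refine ⟨fun h => ?_, fun h => ?_⟩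
    · exact key q' (h ▸ hq'E) hq'N
    · obtain ⟨z, hz, hz'⟩ := h ▸ hq'E
      refine key z hz ?_
      rw [← sixndN_neg, hz']; exact hq'N

end SixData

lemma sixnd_s3 {a b c d : ℝ} (h1 : a * b < 0) (h2 : b * c < 0) (h3 : c * d < 0) : a * d < 0 := by
  rcases mul_neg_iff.1 h1 with ⟨p, q⟩ | ⟨p, q⟩ <;> rcases mul_neg_iff.1 h2 with ⟨p', q'⟩ | ⟨p', q'⟩ <;>
    rcases mul_neg_iff.1 h3 with ⟨p'', q''⟩ | ⟨p'', q''⟩ <;> first | linarith | nlinarith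

namespace SixData
variable {Om : Set (ℝ × ℝ)} {u : ℝ × ℝ → ℝ} {Ψ : ℝ → ℝ}

lemma six_of (l : List (Set (ℝ × ℝ))) (hl : l.Nodup) (h6 : l.length = 6)
    (hc : ∀ K ∈ l, SixComp Om u K) :
    ∃ comps : Finset (Set (ℝ × ℝ)), 6 ≤ comps.card ∧ ∀ K ∈ comps, SixComp Om u K := by
  classical
  refine ⟨l.toFinset, ?_, ?_⟩
  · rw [List.toFinset_card_of_nodup hl, h6]
  · intro K hK; exact hc K (by simpa using hK)

lemma six_of' {a b c d e f : Set (ℝ × ℝ)} (ha : SixComp Om u a) (hb : SixComp Om u b)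
    (hc : SixComp Om u c) (hd : SixComp Om u d) (he : SixComp Om u e) (hf : SixComp Om u f)
    (h1 : a ≠ b ∧ a ≠ c ∧ a ≠ d ∧ a ≠ e ∧ a ≠ f) (h2 : b ≠ c ∧ b ≠ d ∧ b ≠ e ∧ b ≠ f)
    (h3 : c ≠ d ∧ c ≠ e ∧ c ≠ f) (h4 : d ≠ e ∧ d ≠ f) (h5 : e ≠ f) :
    ∃ comps : Finset (Set (ℝ × ℝ)), 6 ≤ comps.card ∧ ∀ K ∈ comps, SixComp Om u K := by
  refine six_of [a, b, c, d, e, f] ?_ rfl ?_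
  · simp only [List.nodup_cons, List.mem_cons, not_or, List.not_mem_nil, not_false_iff, and_true,
      List.nodup_nil]
    exact ⟨h1, h2, h3, h4, h5⟩
  · simp only [List.mem_cons, List.not_mem_nil, or_false]
    rintro K (rfl | rfl | rfl | rfl | rfl | rfl) <;> assumption

lemma att_ne (H : SixData Om u Ψ) {x y : ℝ} {K K' : Set (ℝ × ℝ)} (h : SixAtt Om u x K)
    (h' : SixAtt Om u y K') (hs : Ψ x * Ψ y < 0) : K ≠ K' := by
  rintro rfl
  have hx : Ψ x ≠ 0 := by intro h; rw [h, zero_mul] at hs; exact lt_irrefl _ hs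
  have hy : Ψ y ≠ 0 := by intro h; rw [h, mul_zero] at hs; exact lt_irrefl _ hs
  obtain ⟨hK, t, ht, -, hm⟩ := id h
  have h1 := hm t ht le_rfl
  exact sixnd_sgn2 (H.att_sign hy h' h1) (H.att_sign hx h h1) hs

lemma nocross (H : SixData Om u Ψ) {a b c d : ℝ} {K K' : Set (ℝ × ℝ)}
    (ha : SixAtt Om u a K) (hb : SixAtt Om u b K') (hc : SixAtt Om u c K)
    (hd : SixAtt Om u d K') (hs : Ψ a * Ψ b < 0)
    (hab : a < b) (hbc : b < c) (hcd : c < d) (hda : d < a + 2 * π) : False :=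
  H.att_ne ha hb hs (H.att_cross hab hbc hcd hda ha hc hb hd)

lemma neg_inj {K K' : Set (ℝ × ℝ)} (h : Neg.neg '' K = Neg.neg '' K') : K = K' := by
  rw [← neg_neg_im K, h, neg_neg_im]

lemma neg_swap {K K' : Set (ℝ × ℝ)} (h : K ≠ Neg.neg '' K') : Neg.neg '' K ≠ K' := by
  rintro rfl; exact h (neg_neg_im K).symm

lemma caseA (H : SixData Om u Ψ) {x1 x2 x3 x4 : ℝ} (h12 : x1 < x2) (h23 : x2 < x3) (h34 : x3 < x4)
    (h41 : x4 < x1 + π) (s12 : Ψ x1 * Ψ x2 < 0) (s23 : Ψ x2 * Ψ x3 < 0) (s34 : Ψ x3 * Ψ x4 < 0)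
    {K1 K2 K3 K4 : Set (ℝ × ℝ)} (a1 : SixAtt Om u x1 K1) (a2 : SixAtt Om u x2 K2)
    (a3 : SixAtt Om u x3 K3) (a4 : SixAtt Om u x4 K4) (hself : K1 = Neg.neg '' K1) :
    ∃ comps : Finset (Set (ℝ × ℝ)), 6 ≤ comps.card ∧ ∀ K ∈ comps, SixComp Om u K := by
  have hpi := pi_pos
  have n1 : SixAtt Om u (x1 + π) K1 := by have := H.att_neg a1; rwa [← hself] at this
  have n2 := H.att_neg a2
  have n3 := H.att_neg a3
  have n4 := H.att_neg a4
  have p := H.hper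
  have s14 : Ψ x1 * Ψ x4 < 0 := sixnd_s3 s12 s23 s34
  have hx1 : Ψ x1 ≠ 0 := by intro h; rw [h, zero_mul] at s12; exact lt_irrefl _ s12
  obtain ⟨E, hE, hEs, hEd⟩ := H.enclose hx1 a1 n1
  have E2 := hEd x2 h12 (by linarith) (by linarith) K2 a2
  have E4 := hEd x4 (by linarith) h41 (by linarith) K4 a4
  have d22 : K2 ≠ Neg.neg '' K2 := fun h => by
    rw [← h] at n2
    exact H.nocross a1 a2 n1 n2 s12 h12 (by linarith) (by linarith) (by linarith)
  have d44 : K4 ≠ Neg.neg '' K4 := fun h => by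
    rw [← h] at n4
    exact H.nocross a1 a4 n1 n4 s14 (by linarith) (by linarith) (by linarith) (by linarith)
  have d24 : K2 ≠ Neg.neg '' K4 := fun h => by
    rw [← h] at n4
    exact H.nocross a1 a2 n1 n4 s12 (by linarith) (by linarith) (by linarith) (by linarith)
  have d12 : K1 ≠ K2 := H.att_ne a1 a2 s12
  have d12' : K1 ≠ Neg.neg '' K2 := H.att_ne a1 n2 (by rwa [p])
  have d14 : K1 ≠ K4 := H.att_ne a1 a4 s14
  have d14' : K1 ≠ Neg.neg '' K4 := H.att_ne a1 n4 (by rwa [p])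
  have dE : ∀ {x : ℝ} {K : Set (ℝ × ℝ)}, SixAtt Om u x K → Ψ x * Ψ x2 < 0 → K ≠ E := by
    rintro x K hK hs rfl
    obtain ⟨hK', t, ht, -, hm⟩ := id hK
    have h1 := hm t ht le_rfl
    have h2 := hEs _ h1
    have hx : Ψ x ≠ 0 := by intro h; rw [h, zero_mul] at hs; exact lt_irrefl _ hs
    have h3 := H.att_sign hx hK h1
    have h4 := sixnd_s3 h2 s12 (by linarith : Ψ x2 * Ψ x < 0)
    linarith
  have nE2 : E ≠ K2 := E2.1
  by_cases h31 : K3 = K1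
  · have e24 : K2 ≠ K4 := fun h => by
      rw [← h] at a4
      rw [h31] at a3
      exact H.nocross a1 a2 a3 a4 s12 h12 h23 h34 (by linarith)
    exact six_of' a1.1 hE a2.1 n2.1 a4.1 n4.1
      ⟨dE a1 s12, d12, d12', d14, d14'⟩ ⟨E2.1, E2.2, E4.1, E4.2⟩ ⟨d22, e24, d24⟩
      ⟨neg_swap d24, fun h => e24 (neg_inj h)⟩ d44
  · have d33 : K3 ≠ Neg.neg '' K3 := fun h => by
      rw [← h] at n3
      exact h31 (H.att_cross (by linarith) (by linarith) (by linarith) (by linarith) a1 n1 a3 n3).symm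
    have s32 : Ψ x3 * Ψ x2 < 0 := by linarith
    exact six_of' a1.1 a3.1 n3.1 hE a2.1 n2.1
      ⟨fun h => h31 h.symm, fun h => h31 (neg_inj (h.symm.trans hself)), dE a1 s12, d12, d12'⟩
      ⟨d33, dE a3 s32, H.att_ne a3 a2 s32, H.att_ne a3 n2 (by rwa [p])⟩
      ⟨dE n3 (by rwa [p]), H.att_ne n3 a2 (by rwa [p]), H.att_ne n3 n2 (by rwa [p, p])⟩
      E2 d22

lemma six_comps (H : SixData Om u Ψ) {x1 x2 x3 x4 : ℝ} (h12 : x1 < x2) (h23 : x2 < x3)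
    (h34 : x3 < x4)
    (h41 : x4 < x1 + π) (s12 : Ψ x1 * Ψ x2 < 0) (s23 : Ψ x2 * Ψ x3 < 0) (s34 : Ψ x3 * Ψ x4 < 0) :
    ∃ comps : Finset (Set (ℝ × ℝ)), 6 ≤ comps.card ∧ ∀ K ∈ comps, SixComp Om u K := by
  have hpi := pi_pos
  have p := H.hper
  have s41 : Ψ x4 * Ψ x1 < 0 := by rw [mul_comm]; exact sixnd_s3 s12 s23 s34
  obtain ⟨K1, a1⟩ := H.exists_att (x := x1) (left_ne_zero_of_mul s12.ne)
  obtain ⟨K2, a2⟩ := H.exists_att (x := x2) (left_ne_zero_of_mul s23.ne)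
  obtain ⟨K3, a3⟩ := H.exists_att (x := x3) (left_ne_zero_of_mul s34.ne)
  obtain ⟨K4, a4⟩ := H.exists_att (x := x4) (left_ne_zero_of_mul s41.ne)
  have n1 := H.att_neg a1
  have n2 := H.att_neg a2
  have n3 := H.att_neg a3
  have n4 := H.att_neg a4
  by_cases d11 : K1 = Neg.neg '' K1
  · exact H.caseA h12 h23 h34 h41 s12 s23 s34 a1 a2 a3 a4 d11
  by_cases d22 : K2 = Neg.neg '' K2
  · exact H.caseA h23 h34 h41 (by linarith) s23 s34 (by rwa [p]) a2 a3 a4 n1 d22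
  by_cases d33 : K3 = Neg.neg '' K3
  · exact H.caseA h34 h41 (by linarith : x1 + π < x2 + π) (by linarith) s34 (by rwa [p])
      (by rwa [p, p]) a3 a4 n1 n2 d33
  by_cases d44 : K4 = Neg.neg '' K4
  · exact H.caseA h41 (by linarith : x1 + π < x2 + π) (by linarith : x2 + π < x3 + π) (by linarith)
      (by rwa [p]) (by rwa [p, p]) (by rwa [p, p]) a4 n1 n2 n3 d44
  have d12 : K1 ≠ K2 := H.att_ne a1 a2 s12
  have d12' : K1 ≠ Neg.neg '' K2 := H.att_ne a1 n2 (by rwa [p])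
  have f12 : Neg.neg '' K1 ≠ K2 := neg_swap d12'
  have f12' : Neg.neg '' K1 ≠ Neg.neg '' K2 := fun h => d12 (neg_inj h)
  have s14 : Ψ x1 * Ψ x4 < 0 := by linarith
  have d14 : K1 ≠ K4 := H.att_ne a1 a4 s14
  have d14' : K1 ≠ Neg.neg '' K4 := H.att_ne a1 n4 (by rwa [p])
  have f14 : Neg.neg '' K1 ≠ K4 := neg_swap d14'
  have f14' : Neg.neg '' K1 ≠ Neg.neg '' K4 := fun h => d14 (neg_inj h)
  have s32 : Ψ x3 * Ψ x2 < 0 := by linarith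
  have d32 : K3 ≠ K2 := H.att_ne a3 a2 s32
  have d32' : K3 ≠ Neg.neg '' K2 := H.att_ne a3 n2 (by rwa [p])
  have f32 : Neg.neg '' K3 ≠ K2 := neg_swap d32'
  have f32' : Neg.neg '' K3 ≠ Neg.neg '' K2 := fun h => d32 (neg_inj h)
  have fin24 : K2 ≠ K4 → K2 ≠ Neg.neg '' K4 →
      ∃ comps : Finset (Set (ℝ × ℝ)), 6 ≤ comps.card ∧ ∀ K ∈ comps, SixComp Om u K := by
    intro e e'
    exact six_of' a1.1 n1.1 a2.1 n2.1 a4.1 n4.1 ⟨d11, d12, d12', d14, d14'⟩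
      ⟨f12, f12', f14, f14'⟩ ⟨d22, e, e'⟩ ⟨neg_swap e', fun h => e (neg_inj h)⟩ d44
  by_cases h31 : K3 = K1
  · rw [h31] at a3
    refine fin24 (fun h => ?_) (fun h => ?_)
    · rw [← h] at a4
      exact H.nocross a1 a2 a3 a4 s12 h12 h23 h34 (by linarith)
    · rw [← h] at n4
      exact H.nocross a1 a2 a3 n4 s12 h12 h23 (by linarith) (by linarith)
  by_cases h31' : K3 = Neg.neg '' K1
  · rw [← h31'] at n1
    refine fin24 (fun h => ?_) (fun h => ?_)
    · rw [← h] at a4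
      exact H.nocross a2 a3 a4 n1 s23 h23 h34 h41 (by linarith)
    · have h' : Neg.neg '' K2 = K4 := by rw [h, neg_neg_im]
      rw [h'] at n2
      exact H.nocross a3 a4 n1 n2 s34 h34 h41 (by linarith) (by linarith)
  · exact six_of' a1.1 n1.1 a3.1 n3.1 a2.1 n2.1
      ⟨d11, fun h => h31 h.symm, fun h => h31' (by rw [h, neg_neg_im]), d12, d12'⟩
      ⟨fun h => h31' h.symm, fun h => h31 (neg_inj h).symm, f12, f12'⟩
      ⟨d33, d32, d32'⟩ ⟨f32, f32'⟩ d22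

end SixData

/-- The boundary curve data. -/
structure SixCurve (Om : Set (ℝ × ℝ)) (L : ℝ) (γ : ℝ → ℝ × ℝ) (θ : ℝ → ℝ) : Prop
    extends SixGeo Om where
  hL : 0 < L
  hγs : ContDiff ℝ (⊤ : ℕ∞) γ
  hθs : ContDiff ℝ (⊤ : ℕ∞) θ
  hγper : ∀ s, γ (s + L) = γ s
  hθper : ∀ s, θ (s + L) = θ s + 2 * π
  hrange : Set.range γ = frontier Om
  hinj : Set.InjOn γ (Set.Ico 0 L)
  hγderiv : ∀ s, deriv γ s = (Real.cos (θ s), Real.sin (θ s))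

/-- Tangential component of position. -/
def sixPsi (γ : ℝ → ℝ × ℝ) (θ : ℝ → ℝ) (s : ℝ) : ℝ :=
  (γ s).1 * Real.cos (θ s) + (γ s).2 * Real.sin (θ s)

/-- Normal component of position. -/
def sixQ (γ : ℝ → ℝ × ℝ) (θ : ℝ → ℝ) (s : ℝ) : ℝ :=
  Real.sin (θ s) * (γ s).1 - Real.cos (θ s) * (γ s).2

lemma sixnd_geo {Om : Set (ℝ × ℝ)} (hopen : IsOpen Om) (hne : Om.Nonempty)
    (hbdd : Bornology.IsBounded Om) (hconv : Convex ℝ Om) (hsymm : ∀ p ∈ Om, -p ∈ Om) :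
    SixGeo Om := by
  refine ⟨hopen, hconv, ?_, hbdd, hsymm⟩
  obtain ⟨p, hp⟩ := hne
  have := hconv hp (hsymm p hp) (a := 1 / 2) (b := 1 / 2) (by norm_num) (by norm_num) (by norm_num)
  simpa using this

/-- A maximum with derivative `sin (φ t)`. -/
lemma sixnd_max {f φ : ℝ → ℝ} {s d : ℝ} (hf : ∀ t, HasDerivAt f (Real.sin (φ t)) t) (h0 : φ s = 0)
    (hd : HasDerivAt φ d s) (hmax : ∀ t, f t ≤ f s) : d ≤ 0 := by
  by_contra hcon
  push Not at hcon
  have h1 : ∀ᶠ t in nhdsWithin s (Set.Ioi s), 0 < φ t := by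
    have h2 := (hasDerivWithinAt_iff_tendsto_slope' (s := Set.Ioi s) (by simp)).1
      hd.hasDerivWithinAt
    have h3 := h2.eventually (lt_mem_nhds hcon)
    filter_upwards [h3, self_mem_nhdsWithin] with t ht hts
    rw [slope_def_field, h0, sub_zero] at ht
    exact (div_pos_iff_of_pos_right (sub_pos.2 hts)).1 ht
  have h2 : ∀ᶠ t in nhdsWithin s (Set.Ioi s), φ t < π := by
    have := hd.continuousAt.eventually_lt (continuousAt_const (y := π)) (by rw [h0]; exact pi_pos)
    exact this.filter_mono nhdsWithin_le_nhds
  obtain ⟨b, hb, hsub⟩ := mem_nhdsGT_iff_exists_Ioo_subset.1 (h1.and h2)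
  have hsb : s < b := hb
  obtain ⟨ξ, hξ, he⟩ := exists_hasDerivAt_eq_slope f (fun t => Real.sin (φ t)) hsb
    (fun t _ => (hf t).continuousAt.continuousWithinAt) (fun t _ => hf t)
  have h3 := hsub hξ
  have h4 := Real.sin_pos_of_pos_of_lt_pi h3.1 h3.2
  rw [he] at h4
  have := (div_pos_iff_of_pos_right (sub_pos.2 hsb)).1 h4
  linarith [hmax b]

namespace SixCurve
variable {Om : Set (ℝ × ℝ)} {L : ℝ} {γ : ℝ → ℝ × ℝ} {θ : ℝ → ℝ}

lemma dγ (H : SixCurve Om L γ θ) (s : ℝ) :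
    HasDerivAt γ (Real.cos (θ s), Real.sin (θ s)) s := by
  rw [← H.hγderiv]
  exact (H.hγs.differentiable (by simp) s).hasDerivAt

lemma d1 (H : SixCurve Om L γ θ) (s : ℝ) : HasDerivAt (fun s => (γ s).1) (Real.cos (θ s)) s :=
  (hasFDerivAt_fst (𝕜 := ℝ) (p := γ s)).comp_hasDerivAt s (H.dγ s)

lemma d2 (H : SixCurve Om L γ θ) (s : ℝ) : HasDerivAt (fun s => (γ s).2) (Real.sin (θ s)) s :=
  (hasFDerivAt_snd (𝕜 := ℝ) (p := γ s)).comp_hasDerivAt s (H.dγ s)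

lemma dθ (H : SixCurve Om L γ θ) (s : ℝ) : HasDerivAt θ (deriv θ s) s :=
  (H.hθs.differentiable (by simp) s).hasDerivAt

lemma front (H : SixCurve Om L γ θ) (s : ℝ) : γ s ∈ frontier Om := H.hrange ▸ ⟨s, rfl⟩

lemma clos (H : SixCurve Om L γ θ) (s : ℝ) : γ s ∈ closure Om := frontier_subset_closure (H.front s)

lemma notmem (H : SixCurve Om L γ θ) (s : ℝ) : γ s ∉ Om := by
  have := H.front s
  rw [H.hopen.frontier_eq] at this
  exact this.2

lemma Npos (H : SixCurve Om L γ θ) (s : ℝ) : 0 < sixndN (γ s) := by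
  have h : γ s ≠ 0 := fun h => H.notmem s (h ▸ H.h0)
  by_contra hcon
  apply h
  simp only [sixndN] at hcon
  have h1 : (γ s).1 = 0 := by nlinarith [sq_nonneg (γ s).1, sq_nonneg (γ s).2]
  have h2 : (γ s).2 = 0 := by nlinarith [sq_nonneg (γ s).1, sq_nonneg (γ s).2]
  exact Prod.ext h1 h2

lemma supp (H : SixCurve Om L γ θ) (s : ℝ) : sixQ γ θ s ≠ 0 ∧ ∀ a ∈ closure Om,
    sixQ γ θ s * (Real.sin (θ s) * a.1 - Real.cos (θ s) * a.2) ≤ sixQ γ θ s * sixQ γ θ s := by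
  obtain ⟨f, hf⟩ := geometric_hahn_banach_open_point H.hconv H.hopen (H.notmem s)
  have hfa : ∀ a : ℝ × ℝ, f a = a.1 * f (1, 0) + a.2 * f (0, 1) := by
    intro a
    have : a = a.1 • ((1 : ℝ), (0 : ℝ)) + a.2 • ((0 : ℝ), (1 : ℝ)) := by ext <;> simp
    conv_lhs => rw [this]
    rw [map_add, map_smul, map_smul]; rfl
  have hcl : ∀ a ∈ closure Om, f a ≤ f (γ s) := by
    intro a ha
    exact closure_minimal (fun a ha => (hf a ha).le) (isClosed_le f.continuous continuous_const) ha
  have hd : HasDerivAt (fun t => f (γ t)) (f (Real.cos (θ s), Real.sin (θ s))) s :=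
    f.hasFDerivAt.comp_hasDerivAt s (H.dγ s)
  have hz : f (Real.cos (θ s), Real.sin (θ s)) = 0 :=
    IsLocalMax.hasDerivAt_eq_zero (Filter.Eventually.of_forall fun t => hcl _ (H.clos t)) hd
  set α := f (1, 0) with hα
  set β := f (0, 1) with hβ
  rw [hfa] at hz
  simp only at hz
  have hcs := Real.sin_sq_add_cos_sq (θ s)
  set k := α * Real.sin (θ s) - β * Real.cos (θ s) with hk
  have hαk : α = k * Real.sin (θ s) := by rw [hk]; linear_combination (-α) * hcs + Real.cos (θ s) * hz
  have hβk : β = - k * Real.cos (θ s) := by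
    rw [hk]; linear_combination (-β) * hcs + Real.sin (θ s) * hz
  have hfk : ∀ a : ℝ × ℝ, f a = k * (Real.sin (θ s) * a.1 - Real.cos (θ s) * a.2) := by
    intro a; rw [hfa, hαk, hβk]; ring
  have h0 := hf 0 H.h0
  rw [map_zero, hfk] at h0
  have hkq : 0 < k * sixQ γ θ s := h0
  refine ⟨right_ne_zero_of_mul hkq.ne', fun a ha => ?_⟩
  have h1 := hcl a ha
  rw [hfk, hfk] at h1
  have h1' : k * (Real.sin (θ s) * a.1 - Real.cos (θ s) * a.2) ≤ k * sixQ γ θ s := h1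
  rcases mul_pos_iff.1 hkq with ⟨hk0, hq0⟩ | ⟨hk0, hq0⟩
  · exact mul_le_mul_of_nonneg_left (le_of_mul_le_mul_left h1' hk0) hq0.le
  · exact mul_le_mul_of_nonpos_left ((mul_le_mul_left_of_neg hk0).1 h1') hq0.le

lemma Qcont (H : SixCurve Om L γ θ) : Continuous (sixQ γ θ) := by
  have := H.hγs.continuous
  have := H.hθs.continuous
  unfold sixQ; fun_prop

lemma Psicont (H : SixCurve Om L γ θ) : Continuous (sixPsi γ θ) := by
  have := H.hγs.continuous
  have := H.hθs.continuous
  unfold sixPsi; fun_prop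

lemma dg (H : SixCurve Om L γ θ) (s t : ℝ) :
    HasDerivAt (fun t => Real.sin (θ s) * (γ t).1 - Real.cos (θ s) * (γ t).2)
      (Real.sin (θ s - θ t)) t := by
  rw [Real.sin_sub]
  exact ((H.d1 t).const_mul _).sub ((H.d2 t).const_mul _)

lemma Qpos (H : SixCurve Om L γ θ) (s : ℝ) : 0 < sixQ γ θ s := by
  by_contra hcon
  have hneg : ∀ t, sixQ γ θ t < 0 := by
    intro t
    by_contra ht
    push Not at hcon ht
    obtain ⟨w, hw⟩ := mem_range_of_exists_le_of_exists_ge H.Qcont ⟨s, hcon⟩ ⟨t, ht⟩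
    exact (H.supp w).1 hw
  have hanti : Antitone θ := by
    refine antitone_of_deriv_nonpos (H.hθs.differentiable (by simp)) fun t => ?_
    refine sixnd_max (f := fun t' => - (Real.sin (θ t) * (γ t').1 - Real.cos (θ t) * (γ t').2))
      (φ := fun t' => θ t' - θ t) (s := t) (fun t' => ?_) (by simp) ((H.dθ t).sub_const _) ?_
    · have := (H.dg t t').neg
      rwa [← Real.sin_neg, neg_sub] at this
    · intro t'
      have := (H.supp t).2 _ (H.clos t')
      have := (mul_le_mul_left_of_neg (hneg t)).1 this
      exact neg_le_neg this
  have h1 := hanti (by linarith [H.hL] : (0 : ℝ) ≤ 0 + L)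
  rw [H.hθper] at h1
  linarith [pi_pos]

lemma supp' (H : SixCurve Om L γ θ) (s : ℝ) {a : ℝ × ℝ} (ha : a ∈ closure Om) :
    Real.sin (θ s) * a.1 - Real.cos (θ s) * a.2 ≤ sixQ γ θ s :=
  le_of_mul_le_mul_left ((H.supp s).2 a ha) (H.Qpos s)

lemma θmono (H : SixCurve Om L γ θ) : Monotone θ := by
  refine monotone_of_deriv_nonneg (H.hθs.differentiable (by simp)) fun t => ?_
  have := sixnd_max (f := fun t' => (Real.sin (θ t) * (γ t').1 - Real.cos (θ t) * (γ t').2))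
      (φ := fun t' => θ t - θ t') (s := t) (d := - deriv θ t) (fun t' => H.dg t t') (by simp)
      ((H.dθ t).const_sub _) (fun t' => H.supp' t (H.clos t'))
  linarith

lemma clos_neg (H : SixCurve Om L γ θ) {a : ℝ × ℝ} (ha : a ∈ closure Om) : -a ∈ closure Om := by
  rw [H.clos_iff] at ha ⊢; rwa [H.gneg]

/-- Antipodal points have opposite tangents. -/
lemma anti (H : SixCurve Om L γ θ) {s t : ℝ} (h : γ t = - γ s) :
    Real.cos (θ t - θ s) = -1 := by
  have h1 : HasDerivAt (fun t => Real.sin (θ s) * (γ t).1 - Real.cos (θ s) * (γ t).2)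
      (Real.sin (θ s - θ t)) t := H.dg s t
  have h2 : Real.sin (θ s - θ t) = 0 := by
    refine IsLocalMin.hasDerivAt_eq_zero (Filter.Eventually.of_forall fun w => ?_) h1
    have := H.supp' s (H.clos_neg (H.clos w))
    simp only [h, Prod.fst_neg, Prod.snd_neg, sixQ] at this ⊢
    linarith
  have h3 := H.Qpos s
  have h4 := H.Qpos t
  have h5 := Real.sin_sq_add_cos_sq (θ s - θ t)
  rw [h2] at h5
  have h6 : sixQ γ θ t = - (Real.cos (θ s - θ t) * sixQ γ θ s) := by
    have e1 : Real.sin (θ t) = Real.sin (θ s) * Real.cos (θ s - θ t)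
        - Real.cos (θ s) * Real.sin (θ s - θ t) := by
      rw [← Real.sin_sub]; ring_nf
    have e2 : Real.cos (θ t) = Real.cos (θ s) * Real.cos (θ s - θ t)
        + Real.sin (θ s) * Real.sin (θ s - θ t) := by
      rw [← Real.cos_sub]; ring_nf
    rw [h2] at e1 e2
    simp only [sixQ, h, e1, e2, Prod.fst_neg, Prod.snd_neg]; ring
  rw [← Real.cos_neg, neg_sub]
  have h7 : Real.cos (θ s - θ t) < 0 := by
    by_contra hcon
    push Not at hcon
    nlinarith
  nlinarith

lemma anti_psi (H : SixCurve Om L γ θ) {s t : ℝ} (h : γ t = - γ s) :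
    sixPsi γ θ t = sixPsi γ θ s := by
  have h1 := H.anti h
  have h5 := Real.sin_sq_add_cos_sq (θ t - θ s)
  have h2 : Real.sin (θ t - θ s) = 0 := by rw [h1] at h5; nlinarith
  have e1 : Real.sin (θ t) = - Real.sin (θ s) := by
    have := Real.sin_add (θ s) (θ t - θ s)
    rw [h1, h2] at this
    rw [show θ s + (θ t - θ s) = θ t by ring] at this
    linarith
  have e2 : Real.cos (θ t) = - Real.cos (θ s) := by
    have := Real.cos_add (θ s) (θ t - θ s)
    rw [h1, h2] at this
    rw [show θ s + (θ t - θ s) = θ t by ring] at this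
    linarith
  simp only [sixPsi, h, e1, e2, Prod.fst_neg, Prod.snd_neg]; ring

lemma anti_theta (H : SixCurve Om L γ θ) {s t : ℝ} (h : γ t = - γ s) (hst : s ≤ t)
    (hts : t ≤ s + L) : θ t = θ s + π := by
  have h1 := H.anti h
  have h2 := H.θmono hst
  have h3 := H.θmono hts
  rw [H.hθper] at h3
  have h4 : Real.cos (θ t - θ s - π) = 1 := by rw [Real.cos_sub_pi, h1]; norm_num
  have hpi := pi_pos
  have := (Real.cos_eq_one_iff_of_lt_of_lt (by linarith) (by linarith)).1 h4
  linarith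

lemma dN (H : SixCurve Om L γ θ) (s : ℝ) :
    HasDerivAt (fun s => sixndN (γ s)) (2 * sixPsi γ θ s) s := by
  have := ((H.d1 s).pow 2).add ((H.d2 s).pow 2)
  refine HasDerivAt.congr_deriv this ?_
  simp only [sixPsi]; ring

lemma dPsi (H : SixCurve Om L γ θ) (s : ℝ) :
    HasDerivAt (sixPsi γ θ) (1 - deriv θ s * sixQ γ θ s) s := by
  have := ((H.d1 s).mul (H.dθ s).cos).add ((H.d2 s).mul (H.dθ s).sin)
  have e := Real.sin_sq_add_cos_sq (θ s)
  refine HasDerivAt.congr_deriv this ?_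
  simp only [sixQ]
  linear_combination e

end SixCurve

namespace SixCurve
variable {Om : Set (ℝ × ℝ)} {L : ℝ} {γ : ℝ → ℝ × ℝ} {θ : ℝ → ℝ}

lemma exists_phi0 (H : SixCurve Om L γ θ) : ∃ φ : ℝ → ℝ,
    (∀ s, HasDerivAt φ (sixQ γ θ s / sixndN (γ s)) s) ∧ ∀ s, γ s = sixndG Om (φ s) := by
  set z : ℝ → ℂ := fun s => ((γ s).1 : ℂ) + ((γ s).2 : ℂ) * Complex.I with hz
  set z' : ℝ → ℂ := fun s => (Real.cos (θ s) : ℂ) + (Real.sin (θ s) : ℂ) * Complex.I with hz'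
  have hdz : ∀ s, HasDerivAt z (z' s) s := fun s =>
    (H.d1 s).ofReal_comp.add ((H.d2 s).ofReal_comp.mul_const Complex.I)
  have hz're : ∀ s, (z s).re = (γ s).1 := by intro s; simp [hz]
  have hz'im : ∀ s, (z s).im = (γ s).2 := by intro s; simp [hz]
  have hns : ∀ s, Complex.normSq (z s) = sixndN (γ s) := by
    intro s; rw [Complex.normSq_apply, hz're, hz'im, sixndN]; ring
  have hz0 : ∀ s, z s ≠ 0 := by
    intro s h
    have := hns s
    rw [h, Complex.normSq_zero] at this
    exact (H.Npos s).ne this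
  have hzc : Continuous z := continuous_iff_continuousAt.2 fun s => (hdz s).continuousAt
  have hz'c : Continuous z' := by
    have := H.hθs.continuous
    rw [hz']; fun_prop
  set w : ℝ → ℂ := fun s => z' s / z s with hw
  have hwc : Continuous w := hz'c.div hzc hz0
  set Λ : ℝ → ℂ := fun s => Complex.log (z 0) + ∫ t in (0 : ℝ)..s, w t with hΛ
  have hdΛ : ∀ s, HasDerivAt Λ (w s) s := fun s =>
    (intervalIntegral.integral_hasDerivAt_right (hwc.intervalIntegrable _ _)
      (hwc.stronglyMeasurableAtFilter _ _) hwc.continuousAt).const_add _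
  have hconst : ∀ s, z s * Complex.exp (- Λ s) = z 0 * Complex.exp (- Λ 0) := by
    intro s
    have hd : ∀ s, HasDerivAt (fun s => z s * Complex.exp (- Λ s)) 0 s := by
      intro s
      refine ((hdz s).mul (hdΛ s).neg.cexp).congr_deriv ?_
      simp only [hw]
      field_simp [hz0 s]
      ring
    exact is_const_of_deriv_eq_zero (fun s => (hd s).differentiableAt) (fun s => (hd s).deriv) s 0
  have hexp : ∀ s, z s = Complex.exp (Λ s) := by
    intro s
    have h1 := hconst s
    have h2 : Λ 0 = Complex.log (z 0) := by simp [hΛ]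
    rw [h2, Complex.exp_neg, Complex.exp_neg, Complex.exp_log (hz0 0), mul_inv_cancel₀ (hz0 0)] at h1
    have := Complex.exp_ne_zero (Λ s)
    field_simp at h1
    exact h1
  refine ⟨fun s => (Λ s).im, fun s => ?_, fun s => ?_⟩
  · have h1 : HasDerivAt (fun s => (Λ s).im) (w s).im s := by
      have := (Complex.imCLM.hasFDerivAt (x := Λ s)).comp_hasDerivAt s (hdΛ s)
      exact this
    refine h1.congr_deriv ?_
    simp only [hw, Complex.div_im, hns, hz're, hz'im, sixQ]
    have a1 : (z' s).re = Real.cos (θ s) := by simp [hz', -Complex.ofReal_cos, -Complex.ofReal_sin]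
    have a2 : (z' s).im = Real.sin (θ s) := by simp [hz', -Complex.ofReal_cos, -Complex.ofReal_sin]
    rw [a1, a2]; ring
  · refine H.exists_G (r := Real.exp (Λ s).re) (H.front s) (Real.exp_pos _).le ?_
    have h1 := hexp s
    ext
    · rw [← hz're, h1, Complex.exp_re]; simp [sixndV]
    · rw [← hz'im, h1, Complex.exp_im]; simp [sixndV]

lemma exists_phi (H : SixCurve Om L γ θ) : ∃ φ : ℝ → ℝ, Continuous φ ∧ StrictMono φ ∧
    Function.Surjective φ ∧ (∀ s, γ s = sixndG Om (φ s)) ∧ ∀ s, φ (s + L) = φ s + 2 * π := by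
  obtain ⟨φ, hd, hG⟩ := H.exists_phi0
  have hc : Continuous φ := continuous_iff_continuousAt.2 fun s => (hd s).continuousAt
  have hm : StrictMono φ := strictMono_of_deriv_pos fun s => by
    rw [(hd s).deriv]; exact div_pos (H.Qpos s) (H.Npos s)
  have hG2 : ∀ x, sixndG Om (x + 2 * π) = sixndG Om x := by
    intro x
    rw [show x + 2 * π = x + π + π by ring, H.G_add_pi, H.G_add_pi, neg_neg]
  have hconst : ∀ s, φ (s + L) - φ s = φ (0 + L) - φ 0 := by
    intro s
    have hd' : ∀ s, HasDerivAt (fun s => φ (s + L) - φ s) 0 s := by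
      intro s
      refine ((hd (s + L)).comp_add_const s L |>.sub (hd s)).congr_deriv ?_
      simp [sixQ, H.hγper, H.hθper]
    exact is_const_of_deriv_eq_zero (fun s => (hd' s).differentiableAt) (fun s => (hd' s).deriv) s 0
  have hL := H.hL
  have hD : φ (0 + L) - φ 0 = 2 * π := by
    have h1 : φ 0 < φ (0 + L) := hm (by linarith)
    rcases lt_trichotomy (φ (0 + L) - φ 0) (2 * π) with h | h | h
    · exact absurd ((hG 0).symm.trans ((H.hγper 0).symm.trans (hG _))) (H.G_ne h1 (by linarith))
    · exact h
    · exfalso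
      have h2 : φ 0 + 2 * π ∈ Set.Icc (φ 0) (φ (0 + L)) :=
        ⟨by linarith [pi_pos], by linarith⟩
      obtain ⟨s, hs, hs'⟩ := intermediate_value_Icc (by linarith : (0 : ℝ) ≤ 0 + L)
        hc.continuousOn h2
      have hs0 : s ≠ 0 := by rintro rfl; linarith [pi_pos]
      have hsL : s ≠ 0 + L := by rintro rfl; linarith
      have h3 : γ s = γ 0 := by rw [hG, hG, hs', hG2]
      have h4 : s < L := by rw [zero_add] at hsL hs; exact lt_of_le_of_ne hs.2 hsL
      exact hs0 (H.hinj ⟨hs.1, h4⟩ ⟨le_rfl, hL⟩ h3)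
  have hper : ∀ s, φ (s + L) = φ s + 2 * π := fun s => by linarith [hconst s]
  refine ⟨φ, hc, hm, ?_, hG, hper⟩
  intro x
  have hpi := pi_pos
  have hn : ∀ n : ℤ, φ (n * L) = φ 0 + n * (2 * π) := by
    have hp : Function.Periodic (fun s => φ s - s * (2 * π / L)) L := by
      intro s
      simp only [hper]
      field_simp
      ring
    intro n
    have := hp.int_mul n 0
    simp only [zero_add, zero_mul, sub_zero] at this
    field_simp at this
    linarith
  refine mem_range_of_exists_le_of_exists_ge hc ?_ ?_
  · refine ⟨(⌊(x - φ 0) / (2 * π)⌋ : ℤ) * L, ?_⟩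
    rw [hn]
    have := Int.floor_le ((x - φ 0) / (2 * π))
    rw [le_div_iff₀ (by positivity)] at this
    linarith
  · refine ⟨(⌈(x - φ 0) / (2 * π)⌉ : ℤ) * L, ?_⟩
    rw [hn]
    have := Int.le_ceil ((x - φ 0) / (2 * π))
    rw [div_le_iff₀ (by positivity)] at this
    linarith

end SixCurve

lemma sixnd_zero {f : ℝ → ℝ} {L : ℝ} (hL : 0 < L) (hf : Continuous f) (hper : ∀ s, f (s + L) = f s)
    (hpos : ∀ s, 0 ≤ f s) (hintg : ∫ s in (0 : ℝ)..L, f s = 0) (s : ℝ) : f s = 0 := by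
  by_contra hne
  have hp : Function.Periodic f L := hper
  obtain ⟨y, hy, hxy⟩ := hp.exists_mem_Ico hL s 0
  rw [zero_add] at hy
  have h1 : 0 < f y := by rw [← hxy]; exact lt_of_le_of_ne (hpos s) (Ne.symm hne)
  have := intervalIntegral.integral_pos hL hf.continuousOn (fun x _ => hpos x)
    ⟨y, ⟨hy.1, hy.2.le⟩, h1⟩
  exact this.ne' hintg

namespace SixCurve
variable {Om : Set (ℝ × ℝ)} {L : ℝ} {γ : ℝ → ℝ × ℝ} {θ : ℝ → ℝ}

lemma reduce {φ : ℝ → ℝ} (hm : StrictMono φ) (hs : Function.Surjective φ) {f : ℝ → ℝ}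
    (hf : ∀ s t, φ t = φ s + π → f t = f s) (p s : ℝ) :
    ∃ t, p ≤ t ∧ φ t < φ p + π ∧ f s = f t := by
  obtain ⟨σ, hσ⟩ := hs.hasRightInverse
  have hσ' : ∀ s, σ (φ s) = s := fun s => hm.injective (hσ _)
  have hp : Function.Periodic (fun x => f (σ x)) π := fun x => hf _ _ (by rw [hσ, hσ])
  obtain ⟨y, hy, hxy⟩ := hp.exists_mem_Ico pi_pos (φ s) (φ p)
  refine ⟨σ y, hm.le_iff_le.1 (by rw [hσ]; exact hy.1), by rw [hσ]; exact hy.2, ?_⟩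
  simp only [hσ'] at hxy
  exact hxy

lemma sturm (H : SixCurve Om L γ θ) {φ : ℝ → ℝ} (hm : StrictMono φ)
    (hs : Function.Surjective φ) (hG : ∀ s, γ s = sixndG Om (φ s))
    (hφper : ∀ s, φ (s + L) = φ s + 2 * π)
    (hI0 : ∫ s in (0 : ℝ)..L, sixPsi γ θ s = 0)
    (hI : ∀ α β, ∫ s in (0 : ℝ)..L,
      sixPsi γ θ s * (Real.sin (θ s - α) * Real.sin (θ s - β)) = 0)
    (hne : ∃ s, sixPsi γ θ s ≠ 0) :
    ∃ s1 s2 s3 s4, s1 < s2 ∧ s2 < s3 ∧ s3 < s4 ∧ φ s4 < φ s1 + π ∧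
      0 < sixPsi γ θ s1 ∧ sixPsi γ θ s2 < 0 ∧ 0 < sixPsi γ θ s3 ∧ sixPsi γ θ s4 < 0 := by
  set ψ := sixPsi γ θ with hψ
  have hψc : Continuous ψ := H.Psicont
  have hψper : ∀ s, ψ (s + L) = ψ s := by
    intro s; simp [hψ, sixPsi, H.hγper, H.hθper]
  have hanti : ∀ s t, φ t = φ s + π → γ t = - γ s := by
    intro s t h; rw [hG, h, H.G_add_pi, ← hG]
  have hψτ : ∀ s t, φ t = φ s + π → ψ t = ψ s := fun s t h => H.anti_psi (hanti s t h)
  have hpi := pi_pos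
  obtain ⟨p, hp⟩ : ∃ p, 0 < ψ p := by
    by_contra hcon
    push Not at hcon
    obtain ⟨s, hs⟩ := hne
    apply hs
    have := sixnd_zero (f := fun s => - ψ s) H.hL hψc.neg (fun s => by simp [hψper])
      (fun s => by simpa using hcon s) (by rw [intervalIntegral.integral_neg, hI0, neg_zero]) s
    simpa using this
  obtain ⟨p', hp'⟩ := hs (φ p + π)
  have hpp' : p < p' := hm.lt_iff_lt.1 (by rw [hp']; linarith)
  have hθst : ∀ s t, φ t = φ s + π → θ t = θ s + π := by
    intro s t h
    refine H.anti_theta (hanti _ _ h) (hm.le_iff_le.1 (by rw [h]; linarith))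
      (hm.le_iff_le.1 (by rw [h, hφper]; linarith))
  have hθp' := hθst _ _ hp'
  set N := {s | p < s ∧ s < p' ∧ ψ s < 0} with hN
  have hNne : N.Nonempty := by
    by_contra hcon
    rw [Set.not_nonempty_iff_eq_empty] at hcon
    have h1 : ∀ s, 0 ≤ ψ s := by
      intro s
      obtain ⟨t, ht1, ht2, hst⟩ := reduce hm hs hψτ p s
      rw [hst]
      rcases ht1.eq_or_lt with h | h
      · rw [← h]; exact hp.le
      · by_contra hc
        have : t ∈ N := ⟨h, hm.lt_iff_lt.1 (by rw [hp']; exact ht2), not_le.1 hc⟩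
        rw [hcon] at this
        exact this
    exact hp.ne' (sixnd_zero H.hL hψc hψper h1 hI0 p)
  have hbb : BddBelow N := ⟨p, fun s hs => hs.1.le⟩
  have hba : BddAbove N := ⟨p', fun s hs => hs.2.1.le⟩
  set a := sInf N with ha
  set b := sSup N with hb
  by_cases hex : ∃ s, a < s ∧ s < b ∧ 0 < ψ s
  · obtain ⟨s, h1, h2, h3⟩ := hex
    obtain ⟨n1, hn1, hn1s⟩ := exists_lt_of_csInf_lt hNne h1
    obtain ⟨n2, hn2, hn2s⟩ := exists_lt_of_lt_csSup hNne h2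
    exact ⟨p, n1, s, n2, hn1.1, hn1s, hn2s, by rw [← hp']; exact hm hn2.2.1, hp, hn1.2.2, h3,
      hn2.2.2⟩
  exfalso
  push Not at hex
  have hpa : p ≤ a := le_csInf hNne fun s hs => hs.1.le
  have hab : a ≤ b := csInf_le_csSup hNne hbb hba
  have hbp : b ≤ p' := csSup_le hNne fun s hs => hs.2.1.le
  set F : ℝ → ℝ := fun s => ψ s * (Real.sin (θ s - θ a) * Real.sin (θ s - θ b)) with hF
  have hFc : Continuous F := by
    have := H.hθs.continuous
    rw [hF]; fun_prop
  have hFper : ∀ s, F (s + L) = F s := by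
    intro s
    simp only [hF, hψper, H.hθper]
    rw [show θ s + 2 * π - θ a = θ s - θ a + 2 * π by ring,
      show θ s + 2 * π - θ b = θ s - θ b + 2 * π by ring, Real.sin_add_two_pi, Real.sin_add_two_pi]
  have hFτ : ∀ s t, φ t = φ s + π → F t = F s := by
    intro s t h
    simp only [hF, hψτ s t h, hθst s t h]
    rw [show θ s + π - θ a = θ s - θ a + π by ring,
      show θ s + π - θ b = θ s - θ b + π by ring, Real.sin_add_pi, Real.sin_add_pi]
    ring
  have hmo := H.θmono
  have hFpos : ∀ s, 0 ≤ F s := by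
    intro s
    obtain ⟨t, ht1, ht2, hst⟩ := reduce hm hs hFτ p s
    rw [hst]
    have ht2' : t < p' := hm.lt_iff_lt.1 (by rw [hp']; exact ht2)
    have m1 := hmo ht1
    have m2 := hmo ht2'.le
    have m3 := hmo hpa
    have m4 := hmo hab
    have m5 := hmo hbp
    rw [hθp'] at m2 m5
    have hout : t < a ∨ b < t → 0 ≤ ψ t := by
      intro h
      rcases ht1.eq_or_lt with h' | h'
      · rw [← h']; exact hp.le
      · by_contra hc
        have hmem : t ∈ N := ⟨h', ht2', not_le.1 hc⟩
        rcases h with h | h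
        · exact absurd (csInf_le hbb hmem) (not_le.2 h)
        · exact absurd (le_csSup hba hmem) (not_le.2 h)
    simp only [hF]
    rcases lt_trichotomy t a with h | h | h
    · have n1 := hmo h.le
      refine mul_nonneg (hout (Or.inl h)) (mul_nonneg_of_nonpos_of_nonpos ?_ ?_)
      · exact Real.sin_nonpos_of_nonpos_of_neg_pi_le (by linarith) (by linarith)
      · exact Real.sin_nonpos_of_nonpos_of_neg_pi_le (by linarith) (by linarith)
    · rw [h]; simp
    · have n1 := hmo h.le
      rcases lt_trichotomy t b with h' | h' | h'
      · have n2 := hmo h'.le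
        refine mul_nonneg_of_nonpos_of_nonpos (hex t h h') (mul_nonpos_of_nonneg_of_nonpos ?_ ?_)
        · exact Real.sin_nonneg_of_nonneg_of_le_pi (by linarith) (by linarith)
        · exact Real.sin_nonpos_of_nonpos_of_neg_pi_le (by linarith) (by linarith)
      · rw [h']; simp
      · have n2 := hmo h'.le
        refine mul_nonneg (hout (Or.inr h')) (mul_nonneg ?_ ?_)
        · exact Real.sin_nonneg_of_nonneg_of_le_pi (by linarith) (by linarith)
        · exact Real.sin_nonneg_of_nonneg_of_le_pi (by linarith) (by linarith)
  have hF0 := sixnd_zero H.hL hFc hFper hFpos (hI (θ a) (θ b))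
  obtain ⟨m, -, hmax⟩ := isCompact_Icc.exists_isMaxOn (Set.nonempty_Icc.2 H.hL.le)
    (hψc.continuousOn (s := Set.Icc 0 L))
  have hmax' : ∀ s, ψ s ≤ ψ m := by
    intro s
    have hp : Function.Periodic ψ L := hψper
    obtain ⟨y, hy, hxy⟩ := hp.exists_mem_Ico H.hL s 0
    rw [zero_add] at hy
    rw [hxy]
    exact hmax ⟨hy.1, hy.2.le⟩
  have hd := IsLocalMax.hasDerivAt_eq_zero (Filter.Eventually.of_forall hmax') (H.dPsi m)
  have hθ' : deriv θ m ≠ 0 := by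
    intro h; rw [h] at hd; norm_num at hd
  have hmpos : 0 < ψ m := hp.trans_le (hmax' p)
  have hsin : ∀ α, ∀ᶠ t in nhdsWithin m {m}ᶜ, Real.sin (θ t - α) ≠ 0 := by
    intro α
    have hdα := ((H.dθ m).sub_const α).sin
    by_cases h0 : Real.sin (θ m - α) = 0
    · refine hdα.eventually_ne (mul_ne_zero ?_ hθ')
      intro hc
      have := Real.sin_sq_add_cos_sq (θ m - α)
      rw [h0, hc] at this; norm_num at this
    · exact (hdα.continuousAt.eventually_ne h0).filter_mono nhdsWithin_le_nhds
  have hψev : ∀ᶠ t in nhdsWithin m {m}ᶜ, 0 < ψ t :=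
    ((continuousAt_const (y := (0 : ℝ))).eventually_lt hψc.continuousAt hmpos).filter_mono
      nhdsWithin_le_nhds
  obtain ⟨t, ht1, ht2, ht3⟩ := ((hsin (θ a)).and ((hsin (θ b)).and hψev)).exists
  exact mul_ne_zero ht3.ne' (mul_ne_zero ht1 ht2) (hF0 t)

end SixCurve

/-- Smoothness on a set. -/
abbrev SixSm (U : Set (ℝ × ℝ)) (f : ℝ × ℝ → ℝ) : Prop := ContDiffOn ℝ (⊤ : ℕ∞) f U

namespace SixSm
variable {U : Set (ℝ × ℝ)} {f g : ℝ × ℝ → ℝ}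

lemma dAt (hU : IsOpen U) (hf : SixSm U f) {p : ℝ × ℝ} (hp : p ∈ U) : DifferentiableAt ℝ f p :=
  (hf.contDiffAt (hU.mem_nhds hp)).differentiableAt (by simp)

lemma fd (f : ℝ × ℝ → ℝ) (p v : ℝ × ℝ) : fderiv ℝ f p v = v.1 * pdx f p + v.2 * pdy f p := by
  have : v = v.1 • ((1 : ℝ), (0 : ℝ)) + v.2 • ((0 : ℝ), (1 : ℝ)) := by ext <;> simp
  conv_lhs => rw [this]
  rw [map_add, map_smul, map_smul]; rfl

lemma smfd (hU : IsOpen U) (hf : SixSm U f) : ContDiffOn ℝ (⊤ : ℕ∞) (fderiv ℝ f) U :=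
  hf.fderiv_of_isOpen hU (by simp)

lemma px (hU : IsOpen U) (hf : SixSm U f) : SixSm U (pdx f) :=
  (smfd hU hf).clm_apply contDiffOn_const

lemma py (hU : IsOpen U) (hf : SixSm U f) : SixSm U (pdy f) :=
  (smfd hU hf).clm_apply contDiffOn_const

lemma pcomm (hU : IsOpen U) (hf : SixSm U f) {p : ℝ × ℝ} (hp : p ∈ U) :
    pdx (pdy f) p = pdy (pdx f) p := by
  have h1 : DifferentiableAt ℝ (fderiv ℝ f) p :=
    ((smfd hU hf).contDiffAt (hU.mem_nhds hp)).differentiableAt (by simp)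
  have hs : IsSymmSndFDerivAt ℝ f p :=
    (hf.contDiffAt (hU.mem_nhds hp)).isSymmSndFDerivAt (by
      rw [minSmoothness_of_isRCLikeNormedField]; exact WithTop.coe_le_coe.2 (le_top : (2 : ℕ∞) ≤ ⊤))
  have e1 : pdx (pdy f) p = fderiv ℝ (fderiv ℝ f) p (1, 0) (0, 1) := by
    have : pdy f = fun q => fderiv ℝ f q (0, 1) := rfl
    rw [pdx, this, fderiv_clm_apply h1 (differentiableAt_const _)]
    simp
  have e2 : pdy (pdx f) p = fderiv ℝ (fderiv ℝ f) p (0, 1) (1, 0) := by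
    have : pdx f = fun q => fderiv ℝ f q (1, 0) := rfl
    rw [pdy, this, fderiv_clm_apply h1 (differentiableAt_const _)]
    simp
  rw [e1, e2]
  exact hs _ _

end SixSm

section pdrules
variable {f g : ℝ × ℝ → ℝ} {p : ℝ × ℝ}

lemma pdx_of (f' : ℝ × ℝ →L[ℝ] ℝ) (h : HasFDerivAt f f' p) : pdx f p = f' (1, 0) := by
  rw [pdx, h.fderiv]
lemma pdy_of (f' : ℝ × ℝ →L[ℝ] ℝ) (h : HasFDerivAt f f' p) : pdy f p = f' (0, 1) := by
  rw [pdy, h.fderiv]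

lemma pdx_add (hf : DifferentiableAt ℝ f p) (hg : DifferentiableAt ℝ g p) :
    pdx (fun q => f q + g q) p = pdx f p + pdx g p :=
  pdx_of _ (hf.hasFDerivAt.add hg.hasFDerivAt)
lemma pdy_add (hf : DifferentiableAt ℝ f p) (hg : DifferentiableAt ℝ g p) :
    pdy (fun q => f q + g q) p = pdy f p + pdy g p :=
  pdy_of _ (hf.hasFDerivAt.add hg.hasFDerivAt)
lemma pdx_sub (hf : DifferentiableAt ℝ f p) (hg : DifferentiableAt ℝ g p) :
    pdx (fun q => f q - g q) p = pdx f p - pdx g p :=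
  pdx_of _ (hf.hasFDerivAt.sub hg.hasFDerivAt)
lemma pdy_sub (hf : DifferentiableAt ℝ f p) (hg : DifferentiableAt ℝ g p) :
    pdy (fun q => f q - g q) p = pdy f p - pdy g p :=
  pdy_of _ (hf.hasFDerivAt.sub hg.hasFDerivAt)
lemma pdx_mul (hf : DifferentiableAt ℝ f p) (hg : DifferentiableAt ℝ g p) :
    pdx (fun q => f q * g q) p = pdx f p * g p + f p * pdx g p := by
  refine (pdx_of _ (hf.hasFDerivAt.mul hg.hasFDerivAt)).trans ?_
  simp [pdx]; ring
lemma pdy_mul (hf : DifferentiableAt ℝ f p) (hg : DifferentiableAt ℝ g p) :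
    pdy (fun q => f q * g q) p = pdy f p * g p + f p * pdy g p := by
  refine (pdy_of _ (hf.hasFDerivAt.mul hg.hasFDerivAt)).trans ?_
  simp [pdy]; ring
lemma pdx_cmul (a : ℝ) (hf : DifferentiableAt ℝ f p) :
    pdx (fun q => a * f q) p = a * pdx f p :=
  pdx_of _ (hf.hasFDerivAt.const_mul a)
lemma pdy_cmul (a : ℝ) (hf : DifferentiableAt ℝ f p) :
    pdy (fun q => a * f q) p = a * pdy f p :=
  pdy_of _ (hf.hasFDerivAt.const_mul a)
lemma pdx_congr {V : Set (ℝ × ℝ)} (hV : IsOpen V) (h : Set.EqOn f g V) (hp : p ∈ V) :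
    pdx f p = pdx g p := by
  rw [pdx, pdx, (h.eventuallyEq_of_mem (hV.mem_nhds hp)).fderiv_eq]
lemma pdy_congr {V : Set (ℝ × ℝ)} (hV : IsOpen V) (h : Set.EqOn f g V) (hp : p ∈ V) :
    pdy f p = pdy g p := by
  rw [pdy, pdy, (h.eventuallyEq_of_mem (hV.mem_nhds hp)).fderiv_eq]
lemma pdx_fst : pdx (fun q => q.1) p = 1 := by
  rw [pdx_of _ (hasFDerivAt_fst (𝕜 := ℝ))]; rfl
lemma pdx_snd : pdx (fun q => q.2) p = 0 := by
  rw [pdx_of _ (hasFDerivAt_snd (𝕜 := ℝ))]; rfl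
lemma pdy_fst : pdy (fun q => q.1) p = 0 := by
  rw [pdy_of _ (hasFDerivAt_fst (𝕜 := ℝ))]; rfl
lemma pdy_snd : pdy (fun q => q.2) p = 1 := by
  rw [pdy_of _ (hasFDerivAt_snd (𝕜 := ℝ))]; rfl
/-- Chain rule along a curve. -/
lemma pd_chain {c : ℝ → ℝ × ℝ} {c' : ℝ × ℝ} {t : ℝ} (hf : DifferentiableAt ℝ f (c t))
    (hc : HasDerivAt c c' t) :
    HasDerivAt (fun t => f (c t)) (c'.1 * pdx f (c t) + c'.2 * pdy f (c t)) t := by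
  rw [← SixSm.fd]
  exact hf.hasFDerivAt.comp_hasDerivAt t hc
end pdrules

/-- Eigenfunction, smooth up to the boundary. -/
structure SixEig (Om U : Set (ℝ × ℝ)) (μ : ℝ) (f : ℝ × ℝ → ℝ) : Prop where
  sm : SixSm U f
  eq : ∀ p ∈ Om, lap f p = - μ * f p

namespace SixEig
variable {Om U : Set (ℝ × ℝ)} {μ : ℝ} {f : ℝ × ℝ → ℝ}

lemma px (hO : IsOpen Om) (hU : IsOpen U) (hOU : Om ⊆ U) (h : SixEig Om U μ f) :
    SixEig Om U μ (pdx f) := by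
  refine ⟨h.sm.px hU, fun p hp => ?_⟩
  have e1 : pdx (lap f) p = pdx (fun q => - μ * f q) p := pdx_congr hO (fun q hq => h.eq q hq) hp
  rw [pdx_cmul _ (SixSm.dAt hU h.sm (hOU hp))] at e1
  have e2 : pdx (lap f) p = pdx (pdx (pdx f)) p + pdx (pdy (pdy f)) p :=
    pdx_add (SixSm.dAt hU ((h.sm.px hU).px hU) (hOU hp))
      (SixSm.dAt hU ((h.sm.py hU).py hU) (hOU hp))
  have e3 : pdx (pdy (pdy f)) p = pdy (pdx (pdy f)) p := SixSm.pcomm hU (h.sm.py hU) (hOU hp)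
  have e4 : pdy (pdx (pdy f)) p = pdy (pdy (pdx f)) p :=
    pdy_congr hU (fun q hq => SixSm.pcomm hU h.sm hq) (hOU hp)
  rw [lap, ← e1, e2, e3, e4]

lemma py (hO : IsOpen Om) (hU : IsOpen U) (hOU : Om ⊆ U) (h : SixEig Om U μ f) :
    SixEig Om U μ (pdy f) := by
  refine ⟨h.sm.py hU, fun p hp => ?_⟩
  have e1 : pdy (lap f) p = pdy (fun q => - μ * f q) p := pdy_congr hO (fun q hq => h.eq q hq) hp
  rw [pdy_cmul _ (SixSm.dAt hU h.sm (hOU hp))] at e1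
  have e2 : pdy (lap f) p = pdy (pdx (pdx f)) p + pdy (pdy (pdy f)) p :=
    pdy_add (SixSm.dAt hU ((h.sm.px hU).px hU) (hOU hp))
      (SixSm.dAt hU ((h.sm.py hU).py hU) (hOU hp))
  have e3 : pdx (pdy (pdx f)) p = pdy (pdx (pdx f)) p := SixSm.pcomm hU (h.sm.px hU) (hOU hp)
  have e4 : pdx (pdx (pdy f)) p = pdx (pdy (pdx f)) p :=
    pdx_congr hU (fun q hq => SixSm.pcomm hU h.sm hq) (hOU hp)
  rw [lap, ← e1, e2, e4, e3]

lemma rop_x (hU : IsOpen U) (h : SixSm U f) {p : ℝ × ℝ} (hp : p ∈ U) :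
    pdx (Rop f) p = -p.2 * pdx (pdx f) p + pdy f p + p.1 * pdx (pdy f) p := by
  have d1 := SixSm.dAt hU (h.px hU) hp
  have d2 := SixSm.dAt hU (h.py hU) hp
  have : Rop f = fun q => (-1 * q.2) * pdx f q + q.1 * pdy f q := by
    funext q; simp [Rop]
  rw [this, pdx_add (by fun_prop) (by fun_prop), pdx_mul (by fun_prop) d1, pdx_mul (by fun_prop) d2,
    pdx_cmul _ (by fun_prop), pdx_fst, pdx_snd]
  ring

lemma rop_y (hU : IsOpen U) (h : SixSm U f) {p : ℝ × ℝ} (hp : p ∈ U) :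
    pdy (Rop f) p = - pdx f p - p.2 * pdy (pdx f) p + p.1 * pdy (pdy f) p := by
  have d1 := SixSm.dAt hU (h.px hU) hp
  have d2 := SixSm.dAt hU (h.py hU) hp
  have : Rop f = fun q => (-1 * q.2) * pdx f q + q.1 * pdy f q := by
    funext q; simp [Rop]
  rw [this, pdy_add (by fun_prop) (by fun_prop), pdy_mul (by fun_prop) d1, pdy_mul (by fun_prop) d2,
    pdy_cmul _ (by fun_prop), pdy_fst, pdy_snd]
  ring

lemma rop_sm (hU : IsOpen U) (h : SixSm U f) : SixSm U (Rop f) := by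
  have h1 := h.px hU
  have h2 := h.py hU
  unfold Rop
  exact (contDiffOn_snd.neg.mul h1).add (contDiffOn_fst.mul h2)

lemma rop (hO : IsOpen Om) (hU : IsOpen U) (hOU : Om ⊆ U) (h : SixEig Om U μ f) :
    SixEig Om U μ (Rop f) := by
  refine ⟨rop_sm hU h.sm, fun p hp => ?_⟩
  have hpU := hOU hp
  have hx := h.px hO hU hOU
  have hy := h.py hO hU hOU
  have sxx := hx.sm.px hU
  have sxy := hx.sm.py hU
  have syx := hy.sm.px hU
  have syy := hy.sm.py hU
  have e1 : pdx (pdx (Rop f)) p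
      = pdx (fun q => (-1 * q.2) * pdx (pdx f) q + pdy f q + q.1 * pdx (pdy f) q) p :=
    pdx_congr hU (fun q hq => by simp [rop_x hU h.sm hq]) hpU
  have e2 : pdy (pdy (Rop f)) p
      = pdy (fun q => (-1 * pdx f q) - q.2 * pdy (pdx f) q + q.1 * pdy (pdy f) q) p :=
    pdy_congr hU (fun q hq => by simp [rop_y hU h.sm hq]) hpU
  have d1 := SixSm.dAt hU hx.sm hpU
  have d2 := SixSm.dAt hU hy.sm hpU
  have d3 := SixSm.dAt hU sxx hpU
  have d4 := SixSm.dAt hU sxy hpU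
  have d5 := SixSm.dAt hU syx hpU
  have d6 := SixSm.dAt hU syy hpU
  rw [pdx_add (by fun_prop) (by fun_prop), pdx_add (by fun_prop) (by fun_prop),
    pdx_mul (by fun_prop) d3,
    pdx_mul (by fun_prop) d5, pdx_cmul _ (by fun_prop), pdx_fst, pdx_snd] at e1
  rw [pdy_add (by fun_prop) (by fun_prop), pdy_sub (by fun_prop) (by fun_prop),
    pdy_mul (by fun_prop) d4,
    pdy_mul (by fun_prop) d6, pdy_cmul _ d1, pdy_fst, pdy_snd] at e2
  have c1 := SixSm.pcomm hU h.sm hpU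
  have q1 := hx.eq p hp
  have q2 := hy.eq p hp
  rw [lap] at q1 q2
  rw [lap, e1, e2, Rop]
  linear_combination (-p.2) * q1 + p.1 * q2 + 2 * c1

end SixEig

/-- All the data of the overdetermined problem. -/
structure SixPDE (Om : Set (ℝ × ℝ)) (L : ℝ) (γ : ℝ → ℝ × ℝ) (θ : ℝ → ℝ) (U : Set (ℝ × ℝ))
    (ω : ℝ × ℝ → ℝ) (μ c : ℝ) : Prop extends SixCurve Om L γ θ where
  hU : IsOpen U
  hcU : closure Om ⊆ U
  hω : SixSm U ω
  hpde : ∀ p ∈ Om, lap ω p = - μ * ω p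
  hN : ∀ s, nderiv (θ s) ω (γ s) = 0
  hb : ∀ p ∈ frontier Om, ω p = c
  hμ : 0 < μ

namespace SixPDE
variable {Om : Set (ℝ × ℝ)} {L : ℝ} {γ : ℝ → ℝ × ℝ} {θ : ℝ → ℝ} {U : Set (ℝ × ℝ)}
    {ω : ℝ × ℝ → ℝ} {μ c : ℝ}

lemma hOU (H : SixPDE Om L γ θ U ω μ c) : Om ⊆ U := subset_closure.trans H.hcU

lemma γU (H : SixPDE Om L γ θ U ω μ c) (s : ℝ) : γ s ∈ U := H.hcU (H.clos s)

lemma eig (H : SixPDE Om L γ θ U ω μ c) : SixEig Om U μ ω := ⟨H.hω, H.hpde⟩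

/-- Tangential derivative of a function constant on the boundary. -/
lemma tang (H : SixPDE Om L γ θ U ω μ c) {f : ℝ × ℝ → ℝ} {k : ℝ} (hf : SixSm U f)
    (hk : ∀ s, f (γ s) = k) (s : ℝ) :
    Real.cos (θ s) * pdx f (γ s) + Real.sin (θ s) * pdy f (γ s) = 0 := by
  have h1 := pd_chain (SixSm.dAt H.hU hf (H.γU s)) (H.dγ s)
  have h2 : (fun t => f (γ t)) = fun _ => k := funext hk
  rw [h2] at h1
  exact h1.unique (hasDerivAt_const _ _)

lemma grad (H : SixPDE Om L γ θ U ω μ c) (s : ℝ) : pdx ω (γ s) = 0 ∧ pdy ω (γ s) = 0 := by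
  have h1 := H.tang H.hω (fun s => H.hb _ (H.front s)) s
  have h2 := H.hN s
  rw [nderiv] at h2
  have e := Real.sin_sq_add_cos_sq (θ s)
  constructor
  · linear_combination Real.cos (θ s) * h1 + Real.sin (θ s) * h2 - pdx ω (γ s) * e
  · linear_combination Real.sin (θ s) * h1 - Real.cos (θ s) * h2 - pdy ω (γ s) * e

lemma lapb (H : SixPDE Om L γ θ U ω μ c) (s : ℝ) : lap ω (γ s) = - μ * c := by
  have hcl : Set.EqOn (lap ω) (fun p => - μ * ω p) (closure Om) := by
    refine Set.EqOn.of_subset_closure (s := Om) (fun p hp => H.hpde p hp) ?_ ?_ subset_closure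
      subset_rfl
    · exact ContinuousOn.mono (s := U) (((H.hω.px H.hU).px H.hU).continuousOn.add
        ((H.hω.py H.hU).py H.hU).continuousOn) H.hcU
    · exact (H.hω.continuousOn.mono H.hcU).const_smul (-μ)
  rw [hcl (H.clos s)]
  simp only [H.hb _ (H.front s)]

lemma hess (H : SixPDE Om L γ θ U ω μ c) (s : ℝ) :
    pdx (pdx ω) (γ s) = - μ * c * (Real.sin (θ s) * Real.sin (θ s)) ∧
    pdy (pdx ω) (γ s) = μ * c * (Real.sin (θ s) * Real.cos (θ s)) ∧
    pdx (pdy ω) (γ s) = μ * c * (Real.sin (θ s) * Real.cos (θ s)) ∧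
    pdy (pdy ω) (γ s) = - μ * c * (Real.cos (θ s) * Real.cos (θ s)) := by
  have h1 := H.tang (H.hω.px H.hU) (fun s => (H.grad s).1) s
  have h2 := H.tang (H.hω.py H.hU) (fun s => (H.grad s).2) s
  have h3 := SixSm.pcomm H.hU H.hω (H.γU s)
  have h4 := H.lapb s
  rw [lap] at h4
  rw [h3] at h2 ⊢
  have e := Real.sin_sq_add_cos_sq (θ s)
  set S := Real.sin (θ s)
  set C := Real.cos (θ s)
  set A := pdx (pdx ω) (γ s)
  set B := pdy (pdx ω) (γ s)
  set D := pdy (pdy ω) (γ s)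
  have hB : B = μ * c * (S * C) := by
    linear_combination S * h1 + C * h2 - S * C * h4 - B * e
  refine ⟨?_, hB, hB, ?_⟩
  · linear_combination C * h1 - S * h2 + S * S * h4 - A * e
  · linear_combination S * h2 - C * h1 + C * C * h4 - D * e

lemma u0 (H : SixPDE Om L γ θ U ω μ c) (s : ℝ) : Rop ω (γ s) = 0 := by
  simp [Rop, (H.grad s).1, (H.grad s).2]

lemma ux (H : SixPDE Om L γ θ U ω μ c) (s : ℝ) :
    pdx (Rop ω) (γ s) = μ * c * Real.sin (θ s) * sixPsi γ θ s := by
  rw [SixEig.rop_x H.hU H.hω (H.γU s), (H.hess s).1, (H.hess s).2.2.1, (H.grad s).2, sixPsi]; ring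

lemma uy (H : SixPDE Om L γ θ U ω μ c) (s : ℝ) :
    pdy (Rop ω) (γ s) = - (μ * c * Real.cos (θ s) * sixPsi γ θ s) := by
  rw [SixEig.rop_y H.hU H.hω (H.γU s), (H.hess s).2.1, (H.hess s).2.2.2, (H.grad s).1, sixPsi]; ring

lemma ray (H : SixPDE Om L γ θ U ω μ c) (s : ℝ) (hs : - c * sixPsi γ θ s ≠ 0) :
    ∃ t0 : ℝ, 0 < t0 ∧ t0 < 1 ∧
    ∀ t, 0 < t → t ≤ t0 → 0 < (- c * sixPsi γ θ s) * Rop ω ((1 - t) • γ s) := by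
  have hc : HasDerivAt (fun t : ℝ => (1 - t) • γ s) (- γ s) 0 := by
    have := ((hasDerivAt_id (0 : ℝ)).const_sub 1).smul_const (γ s)
    simpa using this
  have hpt : (1 - (0 : ℝ)) • γ s = γ s := by simp
  have hd := pd_chain (f := Rop ω) (c := fun t : ℝ => (1 - t) • γ s) (t := 0)
    (by simp only [hpt]; exact SixSm.dAt H.hU (SixEig.rop_sm H.hU H.hω) (H.γU s)) hc
  simp only [hpt, H.ux, H.uy] at hd
  have hd2 := hd.const_mul (- c * sixPsi γ θ s)
  have hpos : 0 < - c * sixPsi γ θ s * ((-γ s).1 * (μ * c * Real.sin (θ s) * sixPsi γ θ s) +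
      (-γ s).2 * -(μ * c * Real.cos (θ s) * sixPsi γ θ s)) := by
    have e : - c * sixPsi γ θ s * ((-γ s).1 * (μ * c * Real.sin (θ s) * sixPsi γ θ s) +
      (-γ s).2 * -(μ * c * Real.cos (θ s) * sixPsi γ θ s))
      = μ * sixQ γ θ s * (- c * sixPsi γ θ s) ^ 2 := by
      simp only [sixQ, Prod.fst_neg, Prod.snd_neg]; ring
    rw [e]
    have := H.Qpos s
    have := H.hμ
    positivity
  have h2 := (hasDerivWithinAt_iff_tendsto_slope' (s := Set.Ioi (0 : ℝ)) (by simp)).1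
      hd2.hasDerivWithinAt
  have h3 := h2.eventually (lt_mem_nhds hpos)
  have h4 : ∀ᶠ t in nhdsWithin (0 : ℝ) (Set.Ioi 0),
      0 < (- c * sixPsi γ θ s) * Rop ω ((1 - t) • γ s) := by
    filter_upwards [h3, self_mem_nhdsWithin] with t ht hts
    rw [slope_def_field] at ht
    have hts' : (0 : ℝ) < t := hts
    simp only [sub_zero, one_smul, H.u0, mul_zero] at ht
    exact (div_pos_iff_of_pos_right hts').1 ht
  obtain ⟨b, hb, hsub⟩ := mem_nhdsGT_iff_exists_Ioo_subset.1 h4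
  have hb' : (0 : ℝ) < b := hb
  refine ⟨min (b / 2) (1 / 2), by positivity, (min_le_right _ _).trans_lt (by norm_num), ?_⟩
  intro t ht htt
  exact hsub ⟨ht, by linarith [htt.trans (min_le_left _ _)]⟩

/-- The circle mean-zero property. -/
lemma circle (H : SixPDE Om L γ θ U ω μ c) (r x0 : ℝ) (hr : ∀ x, r • sixndV x ∈ Om)
    (h0 : Rop ω (r • sixndV x0) ≠ 0) :
    ∃ x, Rop ω (r • sixndV x) * Rop ω (r • sixndV x0) < 0 := by
  by_contra hcon
  push Not at hcon
  have hV : ∀ x, HasDerivAt (fun x => r • sixndV x) (r • (- Real.sin x, Real.cos x)) x := fun x =>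
    ((Real.hasDerivAt_cos x).prodMk (Real.hasDerivAt_sin x)).const_smul r
  have hd : ∀ x, HasDerivAt (fun x => ω (r • sixndV x)) (Rop ω (r • sixndV x)) x := by
    intro x
    refine (pd_chain (f := ω) (c := fun x => r • sixndV x) (SixSm.dAt H.hU H.hω (H.hOU (hr x))) (hV x)).congr_deriv ?_
    simp [Rop, sixndV]
  have hcont : Continuous fun x => Rop ω (r • sixndV x) := by
    have h1 : ContinuousOn (Rop ω) Om := (SixEig.rop_sm H.hU H.hω).continuousOn.mono H.hOU
    exact h1.comp_continuous (by unfold sixndV; fun_prop) hr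
  have hper : ∀ x, sixndV (x + 2 * π) = sixndV x := by intro x; simp [sixndV]
  have hintg : ∫ x in (0 : ℝ)..(2 * π), Rop ω (r • sixndV x) = 0 := by
    rw [intervalIntegral.integral_eq_sub_of_hasDerivAt (fun x _ => hd x)
      (hcont.intervalIntegrable _ _)]
    have := hper 0
    rw [zero_add] at this
    rw [this, sub_self]
  have hz := sixnd_zero (f := fun x => Rop ω (r • sixndV x) * Rop ω (r • sixndV x0))
    (L := 2 * π) (by positivity) (by fun_prop) (fun x => by simp only [hper]) hcon
    (by rw [intervalIntegral.integral_mul_const, hintg, zero_mul]) x0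
  exact h0 (by simpa using hz)

end SixPDE

/-- A compactly supported derivative integrates to zero. -/
lemma sixnd_div {Om U : Set (ℝ × ℝ)} (hO : IsOpen Om) (hb : Bornology.IsBounded Om)
    (hU : IsOpen U) (hcU : closure Om ⊆ U) {X : ℝ × ℝ → ℝ} (hX : SixSm U X)
    (h0 : ∀ p ∈ frontier Om, X p = 0) (h1 : ∀ p ∈ frontier Om, fderiv ℝ X p = 0) (v : ℝ × ℝ) :
    ∫ p in Om, fderiv ℝ X p v = 0 := by
  have hK : IsCompact (closure Om) := hb.isCompact_closure
  have hd : ∀ p, HasFDerivAt (Om.indicator X) (Om.indicator (fderiv ℝ X) p) p := by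
    intro p
    by_cases hp : p ∈ Om
    · rw [Set.indicator_of_mem hp]
      refine (SixSm.dAt hU hX (hcU (subset_closure hp))).hasFDerivAt.congr_of_eventuallyEq ?_
      filter_upwards [hO.mem_nhds hp] with q hq
      exact Set.indicator_of_mem hq _
    · rw [Set.indicator_of_notMem hp]
      by_cases hpc : p ∈ closure Om
      · have hf : p ∈ frontier Om := ⟨hpc, by rwa [hO.interior_eq]⟩
        have hXd := (SixSm.dAt hU hX (hcU hpc)).hasFDerivAt
        rw [h1 p hf, hasFDerivAt_iff_isLittleO] at hXd
        rw [hasFDerivAt_iff_isLittleO, Set.indicator_of_notMem hp]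
        simp only [h0 p hf, sub_zero, _root_.zero_apply] at hXd ⊢
        exact (Asymptotics.isBigO_of_le _ fun x => norm_indicator_le_norm_self X x).trans_isLittleO hXd
      · refine (hasFDerivAt_const (0 : ℝ) p).congr_of_eventuallyEq ?_
        filter_upwards [isClosed_closure.isOpen_compl.mem_nhds hpc] with q hq
        exact Set.indicator_of_notMem (fun h => hq (subset_closure h)) _
  have i1 : Integrable (Om.indicator X) := by
    rw [integrable_indicator_iff hO.measurableSet]
    exact ((hX.continuousOn.mono hcU).integrableOn_compact hK).mono_set subset_closure
  have i2 : Integrable (fun p => Om.indicator (fderiv ℝ X) p v) := by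
    have e : (fun p => Om.indicator (fderiv ℝ X) p v) = Om.indicator (fun p => fderiv ℝ X p v) := by
      funext p
      by_cases hp : p ∈ Om <;> simp [hp]
    rw [e, integrable_indicator_iff hO.measurableSet]
    refine (ContinuousOn.integrableOn_compact (K := closure Om) hK ?_).mono_set subset_closure
    exact ((SixSm.smfd hU hX).clm_apply contDiffOn_const).continuousOn.mono hcU
  have key := integral_bilinear_hasFDerivAt_right_eq_neg_left_of_integrable
    (μ := (volume : Measure (ℝ × ℝ)))
    (f := Om.indicator X) (f' := Om.indicator (fderiv ℝ X)) (g := fun _ => (1 : ℝ))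
    (g' := fun _ => 0) (v := v) (B := ContinuousLinearMap.mul ℝ ℝ)
    (by simpa using i2) (by simp) (by simpa using i1) (fun p _ => hd p)
    (fun p _ => hasFDerivAt_const _ _)
  simp only [_root_.zero_apply, map_zero, integral_zero, ContinuousLinearMap.mul_apply',
    mul_one] at key
  rw [← integral_indicator hO.measurableSet]
  have e : (fun p => Om.indicator (fderiv ℝ X) p v) = Om.indicator (fun p => fderiv ℝ X p v) := by
    funext p
    by_cases hp : p ∈ Om <;> simp [hp]
  rw [e] at key
  linarith

/-- The exponential weight. -/
def sixE (a b : ℝ) (p : ℝ × ℝ) : ℝ := Real.exp (a * p.1 + b * p.2)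

lemma sixE_sm (a b : ℝ) (U : Set (ℝ × ℝ)) : SixSm U (sixE a b) := by
  unfold sixE SixSm; fun_prop

lemma sixE_d (a b : ℝ) (p : ℝ × ℝ) : DifferentiableAt ℝ (sixE a b) p := by
  unfold sixE; fun_prop

lemma sixE_x (a b : ℝ) (p : ℝ × ℝ) : pdx (sixE a b) p = a * sixE a b p := by
  have h : HasFDerivAt (sixE a b) _ p :=
    (((hasFDerivAt_fst (𝕜 := ℝ) (p := p)).const_mul a).add
      ((hasFDerivAt_snd (𝕜 := ℝ) (p := p)).const_mul b)).exp
  rw [pdx_of _ h]; simp [sixE, mul_comm]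

lemma sixE_y (a b : ℝ) (p : ℝ × ℝ) : pdy (sixE a b) p = b * sixE a b p := by
  have h : HasFDerivAt (sixE a b) _ p :=
    (((hasFDerivAt_fst (𝕜 := ℝ) (p := p)).const_mul a).add
      ((hasFDerivAt_snd (𝕜 := ℝ) (p := p)).const_mul b)).exp
  rw [pdy_of _ h]; simp [sixE, mul_comm]

/-- Exponentials are complete. -/
lemma sixnd_complete {Om : Set (ℝ × ℝ)} (hO : IsOpen Om) (hb : Bornology.IsBounded Om)
    {w : ℝ × ℝ → ℝ} (hw : ContinuousOn w (closure Om))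
    (h : ∀ a b, ∫ p in Om, w p * sixE a b p = 0) : ∀ p ∈ Om, w p = 0 := by
  have hK : IsCompact (closure Om) := hb.isCompact_closure
  have : CompactSpace (closure Om) := isCompact_iff_compactSpace.1 hK
  have hintg : ∀ g : ℝ × ℝ → ℝ, ContinuousOn g (closure Om) → IntegrableOn g Om := fun g hg =>
    (hg.integrableOn_compact hK).mono_set subset_closure
  have hEc : ∀ a b, Continuous (sixE a b) := fun a b => by unfold sixE; fun_prop
  let e : ℝ → ℝ → C(closure Om, ℝ) := fun a b => ⟨fun p => sixE a b p, by
    exact (hEc a b).comp continuous_subtype_val⟩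
  let S : Set C(closure Om, ℝ) := {f | ∃ a b, f = e a b}
  have hA : (Algebra.adjoin ℝ S).topologicalClosure = ⊤ := by
    apply ContinuousMap.subalgebra_topologicalClosure_eq_top_of_separatesPoints
    intro p q hpq
    have hpq' : (p : ℝ × ℝ) ≠ q := fun h => hpq (Subtype.ext h)
    by_cases h1 : (p : ℝ × ℝ).1 = (q : ℝ × ℝ).1
    · have h2 : (p : ℝ × ℝ).2 ≠ (q : ℝ × ℝ).2 := fun h2 => hpq' (Prod.ext h1 h2)
      exact ⟨_, ⟨e 0 1, Algebra.subset_adjoin ⟨0, 1, rfl⟩, rfl⟩, by simpa [e, sixE] using h2⟩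
    · exact ⟨_, ⟨e 1 0, Algebra.subset_adjoin ⟨1, 0, rfl⟩, rfl⟩, by simpa [e, sixE] using h1⟩
  have hmon : ∀ f ∈ Submonoid.closure S, f ∈ S := by
    intro f hf
    induction hf using Submonoid.closure_induction with
    | mem x hx => exact hx
    | one => exact ⟨0, 0, by ext p; simp [e, sixE]⟩
    | mul x y _ _ hx hy =>
      obtain ⟨a, b, rfl⟩ := hx
      obtain ⟨a', b', rfl⟩ := hy
      refine ⟨a + a', b + b', ?_⟩
      ext p
      simp only [e, sixE, ContinuousMap.mul_apply, ContinuousMap.coe_mk, ← Real.exp_add]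
      congr 1; ring
  have hP : ∀ f ∈ Algebra.adjoin ℝ S, ∃ g : ℝ × ℝ → ℝ, Continuous g ∧ (∀ p : closure Om, f p = g p) ∧
      ∫ p in Om, w p * g p = 0 := by
    intro f hf
    have hf' : f ∈ Submodule.span ℝ (Submonoid.closure S : Set C(closure Om, ℝ)) := by
      rw [← Algebra.adjoin_eq_span]; exact hf
    induction hf' using Submodule.span_induction with
    | mem x hx =>
      obtain ⟨a, b, rfl⟩ := hmon x hx
      exact ⟨sixE a b, hEc a b, fun p => rfl, h a b⟩
    | zero => exact ⟨fun _ => 0, continuous_const, fun p => rfl, by simp⟩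
    | add x y hx hy ihx ihy =>
      obtain ⟨g1, c1, e1, i1⟩ := ihx (by
        rw [← Subalgebra.mem_toSubmodule, Algebra.adjoin_eq_span]; exact hx)
      obtain ⟨g2, c2, e2, i2⟩ := ihy (by
        rw [← Subalgebra.mem_toSubmodule, Algebra.adjoin_eq_span]; exact hy)
      refine ⟨fun p => g1 p + g2 p, by fun_prop, fun p => by simp [e1, e2], ?_⟩
      simp only [mul_add]
      have j1 : IntegrableOn (fun p => w p * g1 p) Om := hintg _ (hw.mul c1.continuousOn)
      have j2 : IntegrableOn (fun p => w p * g2 p) Om := hintg _ (hw.mul c2.continuousOn)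
      rw [integral_add j1 j2, i1, i2, add_zero]
    | smul k x hx ihx =>
      obtain ⟨g1, c1, e1, i1⟩ := ihx (by
        rw [← Subalgebra.mem_toSubmodule, Algebra.adjoin_eq_span]; exact hx)
      refine ⟨fun p => k * g1 p, by fun_prop, fun p => by simp [e1], ?_⟩
      simp only [mul_left_comm _ k]
      rw [integral_const_mul, i1, mul_zero]
  let W : C(closure Om, ℝ) := ⟨fun p => w p, hw.domRestrict⟩
  have hsq : ∫ p in Om, w p * w p = 0 := by
    have hM : 0 ≤ ∫ p in Om, |w p| := integral_nonneg fun p => abs_nonneg _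
    by_contra hne
    have hpos : 0 < |∫ p in Om, w p * w p| := abs_pos.2 hne
    set M := ∫ p in Om, |w p|
    set I := |∫ p in Om, w p * w p|
    have hW : W ∈ closure (Algebra.adjoin ℝ S : Set C(closure Om, ℝ)) := by
      rw [← Subalgebra.topologicalClosure_coe, hA]; trivial
    obtain ⟨f, hf, hfd⟩ := Metric.mem_closure_iff.1 hW (I / (M + 1)) (by positivity)
    obtain ⟨g, cg, eg, ig⟩ := hP f hf
    have e1 : ∫ p in Om, w p * w p = ∫ p in Om, w p * (w p - g p) := by
      simp only [mul_sub]
      have j1 : IntegrableOn (fun p => w p * w p) Om := hintg _ (hw.mul hw)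
      have j2 : IntegrableOn (fun p => w p * g p) Om := hintg _ (hw.mul cg.continuousOn)
      rw [integral_sub j1 j2, ig, sub_zero]
    have e2 : I ≤ ∫ p in Om, |w p| * (I / (M + 1)) := by
      have : I ≤ ∫ p in Om, ‖w p * (w p - g p)‖ := by
        simp only [I, e1]
        exact norm_integral_le_integral_norm (fun p => w p * (w p - g p))
      refine this.trans (setIntegral_mono_on
        (hintg _ (hw.mul (hw.sub cg.continuousOn)).norm)
        (hintg _ ((hw.abs).mul continuousOn_const)) hO.measurableSet fun p hp => ?_)
      rw [norm_mul]
      refine mul_le_mul_of_nonneg_left ?_ (norm_nonneg _)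
      have := (ContinuousMap.dist_apply_le_dist (f := W) (g := f) ⟨p, subset_closure hp⟩).trans hfd.le
      rw [eg, Real.dist_eq] at this
      exact this
    rw [integral_mul_const] at e2
    change I ≤ M * (I / (M + 1)) at e2
    rw [mul_div_assoc', le_div_iff₀ (by positivity)] at e2
    nlinarith
  have hae : (fun p => w p * w p) =ᵐ[volume.restrict Om] fun _ => 0 :=
    (integral_eq_zero_iff_of_nonneg (fun p => mul_self_nonneg _) (hintg _ (hw.mul hw))).1 hsq
  have := Measure.eqOn_open_of_ae_eq hae hO ((hw.mono subset_closure).mul (hw.mono subset_closure))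
    continuousOn_const
  intro p hp
  exact mul_self_eq_zero.1 (this hp)

namespace SixPDE
variable {Om : Set (ℝ × ℝ)} {L : ℝ} {γ : ℝ → ℝ × ℝ} {θ : ℝ → ℝ} {U : Set (ℝ × ℝ)}
    {ω w : ℝ × ℝ → ℝ} {μ c : ℝ}

/-- Zero Cauchy data forces zero. -/
lemma zero (H : SixPDE Om L γ θ U w μ 0) : ∀ p ∈ Om, w p = 0 := by
  have hU := H.hU
  have hfr : ∀ p ∈ frontier Om, w p = 0 ∧ pdx w p = 0 ∧ pdy w p = 0 ∧ pdx (pdx w) p = 0 ∧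
      pdy (pdx w) p = 0 ∧ pdx (pdy w) p = 0 ∧ pdy (pdy w) p = 0 := by
    intro p hp
    rw [← H.hrange] at hp
    obtain ⟨s, rfl⟩ := hp
    obtain ⟨h1, h2, h3, h4⟩ := H.hess s
    simp only [mul_zero, zero_mul] at h1 h2 h3 h4
    exact ⟨H.hb _ (H.front s), (H.grad s).1, (H.grad s).2, h1, h2, h3, h4⟩
  have hfU : ∀ p ∈ frontier Om, p ∈ U := fun p hp => H.hcU (frontier_subset_closure hp)
  have ext0 : ∀ (X : ℝ × ℝ → ℝ) p, pdx X p = 0 → pdy X p = 0 → fderiv ℝ X p = 0 := by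
    intro X p h1 h2
    ext
    · simpa [pdx] using h1
    · simpa [pdy] using h2
  refine sixnd_complete H.hopen H.hbdd (H.hω.continuousOn.mono H.hcU) fun a b => ?_
  have d0 : ∀ p ∈ U, DifferentiableAt ℝ w p := fun p hp => SixSm.dAt hU H.hω hp
  have d1 : ∀ p ∈ U, DifferentiableAt ℝ (pdx w) p := fun p hp => SixSm.dAt hU (H.hω.px hU) hp
  have d2 : ∀ p ∈ U, DifferentiableAt ℝ (pdy w) p := fun p hp => SixSm.dAt hU (H.hω.py hU) hp
  let X : ℝ × ℝ → ℝ := fun p => (pdx w p - a * w p) * sixE a b p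
  let Y : ℝ × ℝ → ℝ := fun p => (pdy w p - b * w p) * sixE a b p
  have sX : SixSm U X := ((H.hω.px hU).sub (contDiffOn_const.mul H.hω)).mul (sixE_sm a b U)
  have sY : SixSm U Y := ((H.hω.py hU).sub (contDiffOn_const.mul H.hω)).mul (sixE_sm a b U)
  have Xx : ∀ p ∈ U, pdx X p = (pdx (pdx w) p - a * a * w p) * sixE a b p := by
    intro p hp
    have := d0 p hp
    have := d1 p hp
    rw [pdx_mul (by fun_prop) (sixE_d a b p), pdx_sub (by fun_prop) (by fun_prop),
      pdx_cmul _ (by fun_prop), sixE_x]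
    ring
  have Xy : ∀ p ∈ U, pdy X p = (pdy (pdx w) p - a * pdy w p + b * (pdx w p - a * w p))
      * sixE a b p := by
    intro p hp
    have := d0 p hp
    have := d1 p hp
    rw [pdy_mul (by fun_prop) (sixE_d a b p), pdy_sub (by fun_prop) (by fun_prop),
      pdy_cmul _ (by fun_prop), sixE_y]
    ring
  have Yx : ∀ p ∈ U, pdx Y p = (pdx (pdy w) p - b * pdx w p + a * (pdy w p - b * w p))
      * sixE a b p := by
    intro p hp
    have := d0 p hp
    have := d2 p hp
    rw [pdx_mul (by fun_prop) (sixE_d a b p), pdx_sub (by fun_prop) (by fun_prop),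
      pdx_cmul _ (by fun_prop), sixE_x]
    ring
  have Yy : ∀ p ∈ U, pdy Y p = (pdy (pdy w) p - b * b * w p) * sixE a b p := by
    intro p hp
    have := d0 p hp
    have := d2 p hp
    rw [pdy_mul (by fun_prop) (sixE_d a b p), pdy_sub (by fun_prop) (by fun_prop),
      pdy_cmul _ (by fun_prop), sixE_y]
    ring
  have IX := sixnd_div H.hopen H.hbdd hU H.hcU sX
    (fun p hp => by obtain ⟨h0, h1, h2, h3, h4, h5, h6⟩ := hfr p hp; simp [X, h0, h1])
    (fun p hp => by
      obtain ⟨h0, h1, h2, h3, h4, h5, h6⟩ := hfr p hp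
      exact ext0 _ _ (by rw [Xx p (hfU p hp)]; simp [h0, h3])
        (by rw [Xy p (hfU p hp)]; simp [h0, h1, h2, h4])) (1, 0)
  have IY := sixnd_div H.hopen H.hbdd hU H.hcU sY
    (fun p hp => by obtain ⟨h0, h1, h2, h3, h4, h5, h6⟩ := hfr p hp; simp [Y, h0, h2])
    (fun p hp => by
      obtain ⟨h0, h1, h2, h3, h4, h5, h6⟩ := hfr p hp
      exact ext0 _ _ (by rw [Yx p (hfU p hp)]; simp [h0, h1, h2, h5])
        (by rw [Yy p (hfU p hp)]; simp [h0, h6])) (0, 1)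
  have hintg : ∀ g : ℝ × ℝ → ℝ, ContinuousOn g U → IntegrableOn g Om := fun g hg =>
    ((hg.mono H.hcU).integrableOn_compact H.hbdd.isCompact_closure).mono_set subset_closure
  have hsum : ∫ p in Om, (pdx X p + pdy Y p) = 0 := by
    rw [integral_add (hintg _ (sX.px hU).continuousOn) (hintg _ (sY.py hU).continuousOn)]
    have e1 : ∫ p in Om, pdx X p = 0 := IX
    have e2 : ∫ p in Om, pdy Y p = 0 := IY
    rw [e1, e2, add_zero]
  have hEq : ∫ p in Om, (pdx X p + pdy Y p) =
      ∫ p in Om, (-(μ + a * a + b * b)) * (w p * sixE a b p) := by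
    refine setIntegral_congr_fun H.hopen.measurableSet fun p hp => ?_
    have h := H.hpde p hp
    rw [lap] at h
    simp only [Xx p (H.hOU hp), Yy p (H.hOU hp)]
    linear_combination sixE a b p * h
  rw [hEq, integral_const_mul] at hsum
  have hμ := H.hμ
  rcases mul_eq_zero.1 hsum with h | h
  · nlinarith [mul_self_nonneg a, mul_self_nonneg b]
  · exact h

lemma pdx_comp_neg {f : ℝ × ℝ → ℝ} {p : ℝ × ℝ} (hf : DifferentiableAt ℝ f (-p)) :
    pdx (fun q => f (-q)) p = - pdx f (-p) := by
  have h : HasFDerivAt (fun q : ℝ × ℝ => f (-q)) _ p :=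
    HasFDerivAt.comp p hf.hasFDerivAt (hasFDerivAt_id p).neg
  rw [pdx_of _ h]
  simp [pdx]

lemma pdy_comp_neg {f : ℝ × ℝ → ℝ} {p : ℝ × ℝ} (hf : DifferentiableAt ℝ f (-p)) :
    pdy (fun q => f (-q)) p = - pdy f (-p) := by
  have h : HasFDerivAt (fun q : ℝ × ℝ => f (-q)) _ p :=
    HasFDerivAt.comp p hf.hasFDerivAt (hasFDerivAt_id p).neg
  rw [pdy_of _ h]
  simp [pdy]

lemma front_neg (H : SixPDE Om L γ θ U ω μ c) (s : ℝ) : ∃ t, γ t = - γ s := by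
  have h : - γ s ∈ frontier Om := by
    refine ⟨H.clos_neg (H.clos s), ?_⟩
    rw [H.hopen.interior_eq]
    intro hm
    exact H.notmem s (by simpa using H.hsymm _ hm)
  rw [← H.hrange] at h
  exact h

lemma even (H : SixPDE Om L γ θ U ω μ c) : ∀ p ∈ Om, ω (-p) = ω p := by
  have hU := H.hU
  let V : Set (ℝ × ℝ) := U ∩ (fun p => -p) ⁻¹' U
  have hV : IsOpen V := hU.inter (hU.preimage continuous_neg)
  have sneg : SixSm V (fun p => ω (-p)) :=
    H.hω.comp (contDiff_neg.contDiffOn) fun p hp => hp.2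
  have hw : SixPDE Om L γ θ V (fun p => ω p - ω (-p)) μ 0 := by
    have gx : ∀ p ∈ V, pdx (fun p => ω p - ω (-p)) p = pdx ω p + pdx ω (-p) := by
      intro p hp
      rw [pdx_sub (SixSm.dAt hU H.hω hp.1) (SixSm.dAt hV sneg hp),
        pdx_comp_neg (SixSm.dAt hU H.hω hp.2)]; ring
    have gy : ∀ p ∈ V, pdy (fun p => ω p - ω (-p)) p = pdy ω p + pdy ω (-p) := by
      intro p hp
      rw [pdy_sub (SixSm.dAt hU H.hω hp.1) (SixSm.dAt hV sneg hp),
        pdy_comp_neg (SixSm.dAt hU H.hω hp.2)]; ring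
    have hcV : closure Om ⊆ V := fun p hp => ⟨H.hcU hp, H.hcU (H.clos_neg hp)⟩
    refine { H.toSixCurve with hU := hV, hcU := hcV, hω := ?_, hpde := ?_, hN := ?_, hb := ?_, hμ := H.hμ }
    · exact (H.hω.mono Set.inter_subset_left).sub sneg
    · intro p hp
      have hpV := hcV (subset_closure hp)
      have sx : SixSm V (fun p => pdx ω (-p)) :=
        (H.hω.px hU).comp (contDiff_neg.contDiffOn) fun p hp => hp.2
      have sy : SixSm V (fun p => pdy ω (-p)) :=
        (H.hω.py hU).comp (contDiff_neg.contDiffOn) fun p hp => hp.2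
      rw [lap, pdx_congr hV gx hpV, pdy_congr hV gy hpV,
        pdx_add (SixSm.dAt hU (H.hω.px hU) hpV.1) (SixSm.dAt hV sx hpV),
        pdy_add (SixSm.dAt hU (H.hω.py hU) hpV.1) (SixSm.dAt hV sy hpV),
        pdx_comp_neg (SixSm.dAt hU (H.hω.px hU) hpV.2),
        pdy_comp_neg (SixSm.dAt hU (H.hω.py hU) hpV.2)]
      have h1 := H.hpde p hp
      have h2 := H.hpde (-p) (H.hsymm p hp)
      rw [lap] at h1 h2
      linear_combination h1 - h2
    · intro s
      obtain ⟨t, ht⟩ := H.front_neg s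
      have hs := hcV (H.clos s)
      rw [nderiv, gx _ hs, gy _ hs, ← ht, (H.grad s).1, (H.grad s).2, (H.grad t).1, (H.grad t).2]
      simp
    · intro p hp
      rw [← H.hrange] at hp
      obtain ⟨s, rfl⟩ := hp
      obtain ⟨t, ht⟩ := H.front_neg s
      simp only [← ht]
      rw [H.hb _ (H.front s), H.hb _ (H.front t), sub_self]
  intro p hp
  have := hw.zero p hp
  linarith

lemma rop_even (H : SixPDE Om L γ θ U ω μ c) : ∀ p ∈ Om, Rop ω (-p) = Rop ω p := by
  intro p hp
  have hd := SixSm.dAt H.hU H.hω (H.hOU (H.hsymm p hp))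
  have h1 := pdx_congr H.hopen (fun q hq => H.even q hq) hp
  have h2 := pdy_congr H.hopen (fun q hq => H.even q hq) hp
  rw [pdx_comp_neg hd] at h1
  rw [pdy_comp_neg hd] at h2
  rw [Rop, Rop, ← h1, ← h2]
  simp

end SixPDE

namespace SixPDE
variable {Om : Set (ℝ × ℝ)} {L : ℝ} {γ : ℝ → ℝ × ℝ} {θ : ℝ → ℝ} {U : Set (ℝ × ℝ)}
    {ω v : ℝ × ℝ → ℝ} {μ c : ℝ}

lemma smulγ (H : SixPDE Om L γ θ U ω μ c) {t : ℝ} (h0 : 0 ≤ t) (h1 : t < 1) (s : ℝ) :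
    t • γ s ∈ Om := by
  have := H.hconv.combo_interior_closure_mem_interior (x := 0) (y := γ s)
    (by rw [H.hopen.interior_eq]; exact H.h0) (H.clos s) (sub_pos.2 h1) h0 (by ring)
  rw [H.hopen.interior_eq] at this
  simpa using this

lemma potential (H : SixPDE Om L γ θ U ω μ c) {P Q : ℝ × ℝ → ℝ} (hP : SixSm U P) (hQ : SixSm U Q)
    (hPQ : ∀ p ∈ Om, pdy P p = pdx Q p) :
    ∃ F : ℝ × ℝ → ℝ, ∀ p ∈ Om, HasFDerivAt F
      (P p • ContinuousLinearMap.fst ℝ ℝ ℝ + Q p • ContinuousLinearMap.snd ℝ ℝ ℝ) p := by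
  have hd : ∀ p ∈ Om, HasFDerivAt (fun p => P p • ContinuousLinearMap.fst ℝ ℝ ℝ +
      Q p • ContinuousLinearMap.snd ℝ ℝ ℝ)
      ((fderiv ℝ P p).smulRight (ContinuousLinearMap.fst ℝ ℝ ℝ) +
        (fderiv ℝ Q p).smulRight (ContinuousLinearMap.snd ℝ ℝ ℝ)) p := by
    intro p hp
    have a1 := (SixSm.dAt H.hU hP (H.hOU hp)).hasFDerivAt.smul_const (ContinuousLinearMap.fst ℝ ℝ ℝ)
    have a2 := (SixSm.dAt H.hU hQ (H.hOU hp)).hasFDerivAt.smul_const (ContinuousLinearMap.snd ℝ ℝ ℝ)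
    exact a1.add a2
  refine H.hconv.exists_forall_hasFDerivAt_of_fderiv_symmetric H.hopen
    (fun p hp => (hd p hp).differentiableAt.differentiableWithinAt) fun p hp x y => ?_
  rw [(hd p hp).fderiv]
  simp only [_root_.add_apply, ContinuousLinearMap.smulRight_apply,
    _root_.smul_apply, ContinuousLinearMap.coe_fst', ContinuousLinearMap.coe_snd',
    smul_eq_mul, SixSm.fd]
  linear_combination (x.2 * y.1 - x.1 * y.2) * hPQ p hp

lemma loop (H : SixPDE Om L γ θ U ω μ c) {P Q : ℝ × ℝ → ℝ} (hP : SixSm U P) (hQ : SixSm U Q)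
    (hPQ : ∀ p ∈ Om, pdy P p = pdx Q p) :
    ∫ s in (0 : ℝ)..L, (P (γ s) * Real.cos (θ s) + Q (γ s) * Real.sin (θ s)) = 0 := by
  obtain ⟨F, hF⟩ := H.potential hP hQ hPQ
  have hγc : Continuous γ := H.hγs.continuous
  have hθc : Continuous θ := H.hθs.continuous
  let k : ℝ → ℝ := fun t => max 0 (min t 1)
  have hkc : Continuous k := by fun_prop
  have hk : ∀ t s, k t • γ s ∈ U := by
    intro t s
    apply H.hcU
    have hk1 : k t ≤ 1 := max_le zero_le_one (min_le_right t 1)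
    rcases lt_or_eq_of_le hk1 with h | h
    · exact subset_closure (H.smulγ (le_max_left _ _) h s)
    · rw [h, one_smul]; exact H.clos s
  let f : ℝ → ℝ → ℝ := fun t s => P (k t • γ s) * Real.cos (θ s) + Q (k t • γ s) * Real.sin (θ s)
  have hfc : Continuous (Function.uncurry f) := by
    have hm : Continuous fun z : ℝ × ℝ => k z.1 • γ z.2 := by fun_prop
    have h1 : Continuous fun z : ℝ × ℝ => P (k z.1 • γ z.2) :=
      hP.continuousOn.comp_continuous hm fun z => hk _ _
    have h2 : Continuous fun z : ℝ × ℝ => Q (k z.1 • γ z.2) :=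
      hQ.continuousOn.comp_continuous hm fun z => hk _ _
    change Continuous fun z : ℝ × ℝ => P (k z.1 • γ z.2) * Real.cos (θ z.2) +
      Q (k z.1 • γ z.2) * Real.sin (θ z.2)
    have hz : Continuous fun z : ℝ × ℝ => θ z.2 := hθc.comp continuous_snd
    exact (h1.mul (Real.continuous_cos.comp hz)).add (h2.mul (Real.continuous_sin.comp hz))
  have hIc : Continuous fun t => ∫ s in (0 : ℝ)..L, f t s :=
    intervalIntegral.continuous_parametric_intervalIntegral_of_continuous' hfc 0 L
  have hI0 : ∀ t ∈ Set.Ioo (0 : ℝ) 1, ∫ s in (0 : ℝ)..L, f t s = 0 := by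
    intro t ht
    have hkt : k t = t := by
      simp only [k]; rw [min_eq_left ht.2.le, max_eq_right ht.1.le]
    have hd : ∀ s, HasDerivAt (fun s => F (t • γ s)) (t * f t s) s := by
      intro s
      have h1 : HasDerivAt (fun s => t • γ s) (t • (Real.cos (θ s), Real.sin (θ s))) s :=
        (H.dγ s).const_smul t
      refine ((hF _ (H.smulγ ht.1.le ht.2 s)).comp_hasDerivAt s h1).congr_deriv ?_
      simp only [f, hkt, _root_.add_apply,
        _root_.smul_apply, ContinuousLinearMap.coe_fst', ContinuousLinearMap.coe_snd',
        smul_eq_mul, Prod.smul_fst, Prod.smul_snd]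
      ring
    have hft : Continuous (f t) := hfc.comp (by fun_prop : Continuous fun s => (t, s))
    have h2 := intervalIntegral.integral_eq_sub_of_hasDerivAt (a := 0) (b := L) (fun x _ => hd x)
      ((continuous_const.mul hft).intervalIntegrable _ _)
    have h3 := H.hγper 0
    rw [zero_add] at h3
    rw [h3, sub_self, intervalIntegral.integral_const_mul] at h2
    exact (mul_eq_zero.1 h2).resolve_left ht.1.ne'
  have hcl : (1 : ℝ) ∈ closure (Set.Ioo (0 : ℝ) 1) := by
    rw [closure_Ioo (by norm_num)]; simp
  have h1 : Set.EqOn (fun t => ∫ s in (0 : ℝ)..L, f t s) (fun _ => 0) (closure (Set.Ioo 0 1)) :=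
    Set.EqOn.closure (fun t ht => hI0 t ht) hIc continuous_const
  have h2 := h1 hcl
  simpa [f, k] using h2

lemma green (H : SixPDE Om L γ θ U ω μ c) (hc : c ≠ 0) (hv : SixEig Om U μ v) :
    ∫ s in (0 : ℝ)..L, v (γ s) * sixPsi γ θ s = 0 := by
  have hU := H.hU
  have hu := SixEig.rop H.hopen hU H.hOU H.eig
  set u := Rop ω with hudef
  have sP : SixSm U (fun p => u p * pdy v p - v p * pdy u p) :=
    (hu.sm.mul (hv.sm.py hU)).sub (hv.sm.mul (hu.sm.py hU))
  have sQ : SixSm U (fun p => v p * pdx u p - u p * pdx v p) :=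
    (hv.sm.mul (hu.sm.px hU)).sub (hu.sm.mul (hv.sm.px hU))
  have key := H.loop sP sQ (by
    intro p hp
    have hpU := H.hOU hp
    have d1 := SixSm.dAt hU hu.sm hpU
    have d2 := SixSm.dAt hU hv.sm hpU
    have d3 := SixSm.dAt hU (hu.sm.px hU) hpU
    have d4 := SixSm.dAt hU (hu.sm.py hU) hpU
    have d5 := SixSm.dAt hU (hv.sm.px hU) hpU
    have d6 := SixSm.dAt hU (hv.sm.py hU) hpU
    rw [pdy_sub (by fun_prop) (by fun_prop), pdx_sub (by fun_prop) (by fun_prop),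
      pdy_mul d1 d6, pdy_mul d2 d4, pdx_mul d2 d3, pdx_mul d1 d5]
    have h1 := hu.eq p hp
    have h2 := hv.eq p hp
    rw [lap] at h1 h2
    linear_combination u p * h2 - v p * h1)
  have e : ∀ s, (u (γ s) * pdy v (γ s) - v (γ s) * pdy u (γ s)) * Real.cos (θ s) +
      (v (γ s) * pdx u (γ s) - u (γ s) * pdx v (γ s)) * Real.sin (θ s) =
      (μ * c) * (v (γ s) * sixPsi γ θ s) := by
    intro s
    rw [hudef, H.u0, H.ux, H.uy]
    linear_combination (μ * c * v (γ s) * sixPsi γ θ s) * Real.sin_sq_add_cos_sq (θ s)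
  simp only [e] at key
  rw [intervalIntegral.integral_const_mul] at key
  exact (mul_eq_zero.1 key).resolve_left (mul_ne_zero H.hμ.ne' hc)

lemma hI (H : SixPDE Om L γ θ U ω μ c) (hc : c ≠ 0) (α β : ℝ) :
    ∫ s in (0 : ℝ)..L, sixPsi γ θ s * (Real.sin (θ s - α) * Real.sin (θ s - β)) = 0 := by
  have hU := H.hU
  have hmc : μ * c ≠ 0 := mul_ne_zero H.hμ.ne' hc
  have ex := H.eig.px H.hopen hU H.hOU
  have ey := H.eig.py H.hopen hU H.hOU
  have i1 := H.green hc (ex.px H.hopen hU H.hOU)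
  have i2 := H.green hc (ex.py H.hopen hU H.hOU)
  have i3 := H.green hc (ey.py H.hopen hU H.hOU)
  have hγc : Continuous γ := H.hγs.continuous
  have hψ := H.Psicont
  have hc1 : ∀ {f : ℝ × ℝ → ℝ}, SixSm U f →
      IntervalIntegrable (fun s => f (γ s) * sixPsi γ θ s) volume 0 L := fun {f} hf =>
    ((hf.continuousOn.comp_continuous hγc H.γU).mul hψ).intervalIntegrable _ _
  have e : ∀ s, sixPsi γ θ s * (Real.sin (θ s - α) * Real.sin (θ s - β)) =
      (μ * c)⁻¹ * (-(Real.cos α * Real.cos β) * (pdx (pdx ω) (γ s) * sixPsi γ θ s) +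
      (-(Real.cos α * Real.sin β + Real.sin α * Real.cos β)) * (pdy (pdx ω) (γ s) * sixPsi γ θ s) +
      (-(Real.sin α * Real.sin β)) * (pdy (pdy ω) (γ s) * sixPsi γ θ s)) := by
    intro s
    obtain ⟨h1, h2, h3, h4⟩ := H.hess s
    rw [h1, h2, h4, Real.sin_sub, Real.sin_sub]
    have hμ0 := H.hμ.ne'
    field_simp
    ring
  simp only [e]
  have s1 := hc1 (ex.px H.hopen hU H.hOU).sm
  have s2 := hc1 (ex.py H.hopen hU H.hOU).sm
  have s3 := hc1 (ey.py H.hopen hU H.hOU).sm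
  rw [intervalIntegral.integral_const_mul, intervalIntegral.integral_add
    ((s1.const_mul _).add (s2.const_mul _)) (s3.const_mul _),
    intervalIntegral.integral_add (s1.const_mul _) (s2.const_mul _),
    intervalIntegral.integral_const_mul, intervalIntegral.integral_const_mul,
    intervalIntegral.integral_const_mul, i1, i2, i3]
  ring

end SixPDE

namespace SixCurve
variable {Om : Set (ℝ × ℝ)} {L : ℝ} {γ : ℝ → ℝ × ℝ} {θ : ℝ → ℝ}

lemma hI0 (H : SixCurve Om L γ θ) : ∫ s in (0 : ℝ)..L, sixPsi γ θ s = 0 := by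
  have h := intervalIntegral.integral_eq_sub_of_hasDerivAt (a := 0) (b := L) (fun s _ => H.dN s)
    ((continuous_const.mul H.Psicont).intervalIntegrable _ _)
  have h3 := H.hγper 0
  rw [zero_add] at h3
  rw [h3, sub_self, intervalIntegral.integral_const_mul] at h
  linarith

end SixCurve

namespace SixCurve
variable {Om : Set (ℝ × ℝ)} {L : ℝ} {γ : ℝ → ℝ × ℝ} {θ : ℝ → ℝ}

lemma disk (H : SixCurve Om L γ θ) (h : ∀ s, sixPsi γ θ s = 0) : IsDisk Om := by
  have hconst : ∀ s, sixndN (γ s) = sixndN (γ 0) := fun s =>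
    is_const_of_deriv_eq_zero (fun s => (H.dN s).differentiableAt)
      (fun s => by rw [(H.dN s).deriv, h, mul_zero]) s 0
  have hN := H.Npos 0
  refine ⟨0, Real.sqrt (sixndN (γ 0)), Real.sqrt_pos.2 hN, ?_⟩
  ext p
  rw [Set.mem_ofPred_eq, Real.sq_sqrt hN.le]
  obtain ⟨r, x, hr, hr2, hp⟩ := sixnd_polar p
  have e1 : (p.1 - (0 : ℝ × ℝ).1) ^ 2 + (p.2 - (0 : ℝ × ℝ).2) ^ 2 = r ^ 2 := by
    rw [hr2, sixndN]; simp
  have hg := H.gpos (sixndV_ne x)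
  have hf := H.frontG x
  rw [← H.hrange] at hf
  obtain ⟨s, hs⟩ := hf
  have e2 : sixndN (γ 0) = ((gauge Om (sixndV x))⁻¹) ^ 2 := by
    rw [← hconst s, hs, sixndN, sixndG, sixndV]
    simp only [Prod.smul_fst, Prod.smul_snd, smul_eq_mul]
    linear_combination ((gauge Om (Real.cos x, Real.sin x))⁻¹) ^ 2 * Real.sin_sq_add_cos_sq x
  rw [e1, e2, sq_lt_sq₀ hr (by positivity), H.mem_iff, hp, gauge_smul_of_nonneg hr, smul_eq_mul,
    ← lt_div_iff₀ hg, one_div]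

end SixCurve

namespace SixPDE
variable {Om : Set (ℝ × ℝ)} {L : ℝ} {γ : ℝ → ℝ × ℝ} {θ : ℝ → ℝ} {U : Set (ℝ × ℝ)}
    {ω v : ℝ × ℝ → ℝ} {μ c : ℝ}

lemma main (H : SixPDE Om L γ θ U ω μ c) (hc : c ≠ 0) (hnd : ¬ IsDisk Om) :
    ∃ comps : Finset (Set (ℝ × ℝ)), 6 ≤ comps.card ∧ ∀ K ∈ comps, SixComp Om (Rop ω) K := by
  obtain ⟨φ, hφc, hφm, hφs, hG, hφper⟩ := H.exists_phi
  obtain ⟨σ, hσ⟩ := hφs.hasRightInverse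
  have hσφ : ∀ s, σ (φ s) = s := fun s => hφm.injective (hσ (φ s))
  have hGσ : ∀ x, sixndG Om x = γ (σ x) := fun x => by rw [hG, hσ x]
  have hne : ∃ s, sixPsi γ θ s ≠ 0 := by
    by_contra hcon
    push Not at hcon
    exact hnd (H.disk hcon)
  obtain ⟨s1, s2, s3, s4, h12, h23, h34, h41, p1, p2, p3, p4⟩ :=
    H.sturm hφm hφs hG hφper H.hI0 (H.hI hc) hne
  have D : SixData Om (Rop ω) (fun x => - c * sixPsi γ θ (σ x)) := by
    refine { H.toSixGeo with hu := ?_, heven := H.rop_even, hcircle := H.circle, hΨ := ?_, hper := ?_, hmin := ?_ }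
    · exact (SixEig.rop_sm H.hU H.hω).continuousOn.mono H.hOU
    · intro x hx
      rw [hGσ]
      exact H.ray (σ x) hx
    · intro x
      have : γ (σ (x + π)) = - γ (σ x) := by rw [← hGσ, ← hGσ, H.G_add_pi]
      simp only [H.anti_psi this]
    · intro x hx
      have hm : IsLocalMin (fun s => sixndN (γ s)) (σ x) := by
        refine Filter.Eventually.of_forall fun s => ?_
        have := hx (φ s)
        rwa [← hG, hGσ] at this
      have h0 := hm.hasDerivAt_eq_zero (H.dN (σ x))
      have h1 : sixPsi γ θ (σ x) = 0 := by linarith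
      simp only [h1, mul_zero]
  have hc2 : 0 < c * c := mul_self_pos.2 hc
  refine D.six_comps (hφm h12) (hφm h23) (hφm h34) h41 ?_ ?_ ?_
  · simp only [hσφ]
    nlinarith [mul_pos hc2 (mul_pos p1 (neg_pos.2 p2))]
  · simp only [hσφ]
    nlinarith [mul_pos hc2 (mul_pos p3 (neg_pos.2 p2))]
  · simp only [hσφ]
    nlinarith [mul_pos hc2 (mul_pos p3 (neg_pos.2 p4))]

end SixPDE

/-- If `Ω` is strictly convex, centrally symmetric, not a disk,
then `Rω` has at least 6 nodal domains in `Ω`. -/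
theorem rotation_has_six_nodal_domains
    (Om : Set (ℝ × ℝ)) (hopen : IsOpen Om) (hconn : IsConnected Om)
    (hbdd : Bornology.IsBounded Om)
    (hconvex : StrictConvex ℝ Om)
    (hsymm : ∀ p ∈ Om, -p ∈ Om)
    (L : ℝ) (hL : 0 < L)
    (γ : ℝ → ℝ × ℝ) (θ : ℝ → ℝ)
    (hγsmooth : ContDiff ℝ (⊤ : ℕ∞) γ) (hθsmooth : ContDiff ℝ (⊤ : ℕ∞) θ)
    (hγper : ∀ s, γ (s + L) = γ s)
    (hθper : ∀ s, θ (s + L) = θ s + 2 * π)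
    (hrange : Set.range γ = frontier Om)
    (hinj : Set.InjOn γ (Set.Ico 0 L))
    (hγderiv : ∀ s, deriv γ s = (Real.cos (θ s), Real.sin (θ s)))
    (ω : ℝ × ℝ → ℝ) (μ : ℝ) (c : ℝ) (hμpos : 0 < μ) (hc : c ≠ 0)
    (hωsmooth : SmoothNearClosure Om ω)
    (hωpde : ∀ p ∈ Om, - lap ω p = μ * ω p)
    (hωNeumann : ∀ s, nderiv (θ s) ω (γ s) = 0)
    (hωbdry : ∀ p ∈ frontier Om, ω p = c)
    (hnotdisk : ¬ IsDisk Om) :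
    ∃ comps : Finset (Set (ℝ × ℝ)), 6 ≤ comps.card ∧
      ∀ C ∈ comps, ∃ p : ℝ × ℝ, p ∈ Om ∧ Rop ω p ≠ 0 ∧
        C = connectedComponentIn {q : ℝ × ℝ | q ∈ Om ∧ Rop ω q ≠ 0} p := by
  obtain ⟨U, hU, hcU, hω⟩ := hωsmooth
  have hgeo : SixGeo Om := sixnd_geo hopen hconn.nonempty hbdd hconvex.convex hsymm
  have H : SixPDE Om L γ θ U ω μ c :=
    { hgeo with
      hL := hL, hγs := hγsmooth, hθs := hθsmooth, hγper := hγper, hθper := hθper,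
      hrange := hrange, hinj := hinj, hγderiv := hγderiv, hU := hU, hcU := hcU, hω := hω,
      hpde := fun p hp => by linarith [hωpde p hp]
      hN := hωNeumann, hb := hωbdry, hμ := hμpos }
  exact H.main hc hnotdisk
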